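/- arXiv:2106.02312 — 8 statements merged into one kernel-verified Lean document; each statement's English description precedes it below -/
import Mathlib

section
/- Let A be a reduced (minimal) complete deterministic finite automaton over a finite alphabet Σ, with transition graph Γ and transition semigroup S, and let L be the set of nonempty words accepted by A. Then L is locally testable if and only if for every C-node (p,q) of Γ² with p ⪰ q the following two conditions hold: (1) if also q ⪰ p, then p = q; (2) for every s ∈ S, p·s ⪰ q if and only if q·s ⪰ q. -/
/-- Extended transition function of a DFA: `deltaStar δ q w` is the state reached
from `q` by reading the word `w`. -/
def deltaStar {Q A : Type*} (δ : Q → A → Q) (q : Q) (w : List A) : Q :=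
  w.foldl δ q

/-- `p ⪰ q` : the state `q` is reachable from `p` (by some possibly empty word). -/
def Reach {Q A : Type*} (δ : Q → A → Q) (p q : Q) : Prop :=
  ∃ w : List A, deltaStar δ p w = q

/-- `(p, q)` is a C-node of `Γ²`: some element of the transition semigroup
(i.e. some nonempty word) fixes both `p` and `q`. -/
def CNode {Q A : Type*} (δ : Q → A → Q) (p q : Q) : Prop :=
  ∃ w : List A, w ≠ [] ∧ deltaStar δ p w = p ∧ deltaStar δ q w = q

/-- The transition semigroup of a DFA: the transformations of the state set
induced by nonempty words. -/
def TransSemigroup {Q A : Type*} (δ : Q → A → Q) : Set (Q → Q) :=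
  {f | ∃ w : List A, w ≠ [] ∧ ∀ q, f q = deltaStar δ q w}

/-- `L` is `k`-testable: membership of a nonempty word is determined by its prefix
and suffix of length `k-1` and its set of factors of length `k`. -/
def KTestable {A : Type*} (L : Set (List A)) (k : ℕ) : Prop :=
  ∀ u v : List A, u ≠ [] → v ≠ [] →
    u.take (k - 1) = v.take (k - 1) →
    u.drop (u.length - (k - 1)) = v.drop (v.length - (k - 1)) →
    (∀ f : List A, f.length = k → (f <:+: u ↔ f <:+: v)) →
    (u ∈ L ↔ v ∈ L)

/-- `L` is locally testable: it is `k`-testable for some `k ≥ 1`. -/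
def LocallyTestable {A : Type*} (L : Set (List A)) : Prop :=
  ∃ k ≥ 1, KTestable L k

section Paths

variable {V E : Type*} (src tgt : E → V)

/-- `IsPath src tgt p l q` : the edges in `l` form a path from `p` to `q`. -/
def IsPath : V → List E → V → Prop
  | p, [], q => p = q
  | p, e :: l, q => src e = p ∧ IsPath (tgt e) l q

variable {src tgt}

theorem isPath_append {p q : V} {a b : List E} :
    IsPath src tgt p (a ++ b) q ↔ ∃ r, IsPath src tgt p a r ∧ IsPath src tgt r b q := by
  induction a generalizing p with
  | nil => simp [IsPath]
  | cons e l ih => simp [IsPath, ih, and_assoc]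

theorem IsPath.append {p q r : V} {a b : List E} (ha : IsPath src tgt p a r)
    (hb : IsPath src tgt r b q) : IsPath src tgt p (a ++ b) q :=
  isPath_append.2 ⟨r, ha, hb⟩

theorem IsPath.cons {q : V} {e : E} {l : List E} (h : IsPath src tgt (tgt e) l q) :
    IsPath src tgt (src e) (e :: l) q :=
  ⟨rfl, h⟩

theorem isPath_append_cons {p q : V} {e : E} {a b : List E} :
    IsPath src tgt p (a ++ e :: b) q ↔
      IsPath src tgt p a (src e) ∧ IsPath src tgt (tgt e) b q := by
  rw [isPath_append]
  constructor
  · rintro ⟨r, ha, rfl, hb⟩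
    exact ⟨ha, hb⟩
  · rintro ⟨ha, hb⟩
    exact ⟨_, ha, hb.cons⟩

variable (src tgt) in
/-- A valuation of edge lists for which loops occurring after a path from `p` are idempotent
and commute with each other. -/
structure LoopSemilattice {β : Type*} (p : V) (val : List E → β) : Prop where
  idem : ∀ {v : V} {a x : List E} (b : List E), IsPath src tgt p a v → IsPath src tgt v x v →
    val (a ++ (x ++ (x ++ b))) = val (a ++ (x ++ b))
  comm : ∀ {v : V} {a x y : List E} (b : List E), IsPath src tgt p a v → IsPath src tgt v x v →
    IsPath src tgt v y v → val (a ++ (x ++ (y ++ b))) = val (a ++ (y ++ (x ++ b)))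

namespace LoopSemilattice

variable {β : Type*} {p : V} {val : List E → β}

theorem exists_return (h : LoopSemilattice src tgt p val) {a : List E} {r : V}
    (ha : IsPath src tgt p a r) (w : List E) :
    ∀ t, IsPath src tgt r w t → w ⊆ a →
      ∃ z, IsPath src tgt t z r ∧ ∀ b, val (a ++ b) = val (a ++ (w ++ (z ++ b))) := by
  induction w using List.reverseRecOn with
  | nil =>
    intro t hw _
    obtain rfl : r = t := hw
    exact ⟨[], rfl, fun b => rfl⟩
  | append_singleton w e ih =>
    intro t hw hsub
    obtain ⟨hw', ht⟩ := isPath_append_cons.1 hw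
    obtain rfl : tgt e = t := ht
    obtain ⟨z, hz, hval⟩ := ih _ hw' fun x hx => hsub (by simp [hx])
    obtain ⟨a₁, a₂, rfl⟩ := List.append_of_mem (hsub (by simp : e ∈ w ++ [e]))
    obtain ⟨ha₁, ha₂⟩ := isPath_append_cons.1 ha
    refine ⟨a₂ ++ (w ++ z), ha₂.append (hw'.append hz), fun b => ?_⟩
    rw [hval]
    have := h.idem (z ++ b) ha₁ (ha₂.append hw').cons
    simpa using this.symm

theorem absorb (h : LoopSemilattice src tgt p val) {a w : List E} {r : V}
    (ha : IsPath src tgt p a r) (hw : IsPath src tgt r w r) (hsub : w ⊆ a) (b : List E) :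
    val (a ++ (w ++ b)) = val (a ++ b) := by
  obtain ⟨z, hz, hval⟩ := h.exists_return ha w r hw hsub
  have h1 := h.comm b (ha.append hw) hz hw
  have h2 := h.idem (z ++ b) ha hw
  simp only [List.append_assoc] at h1 h2
  rw [hval (w ++ b), h1, h2, ← hval]

theorem absorb_split (h : LoopSemilattice src tgt p val) {q : V} (x : List E) :
    ∀ (a b y : List E) (r : V), IsPath src tgt p a r → IsPath src tgt r (x ++ y) r →
      IsPath src tgt r b q → y ⊆ a → x ⊆ a ++ b →
      val (a ++ (x ++ (y ++ b))) = val (a ++ b) := by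
  induction x with
  | nil =>
    intro a b y r ha hw _ hy _
    exact h.absorb ha hw hy b
  | cons e x ih =>
    intro a b y r ha hw hb hy hx
    obtain ⟨rfl, hw⟩ := hw
    have hloop : IsPath src tgt (src e) (e :: (x ++ y)) (src e) := hw.cons
    have hrot : IsPath src tgt (tgt e) (x ++ (y ++ [e])) (tgt e) := by
      rw [← List.append_assoc]
      exact isPath_append_cons.2 ⟨hw, rfl⟩
    by_cases hea : e ∈ a
    · obtain ⟨a₁, a₂, rfl⟩ := List.append_of_mem hea
      obtain ⟨ha₁, ha₂⟩ := isPath_append_cons.1 ha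
      have key := ih ((a₁ ++ e :: a₂) ++ [e]) (a₂ ++ b) (y ++ [e]) (tgt e)
        (isPath_append_cons.2 ⟨ha, rfl⟩) hrot (ha₂.append hb)
        (by intro t ht; have := @hy t; grind)
        (by intro t ht; have := @hx t; grind)
      have h1 := h.comm b ha hloop ha₂.cons
      have h2 := h.absorb ha ha₂.cons (by intro t ht; grind) b
      have h3 := h.absorb ha ha₂.cons (by intro t ht; grind) (e :: (x ++ (y ++ b)))
      simp only [List.append_assoc, List.cons_append, List.nil_append] at *
      rw [← h3, ← h1, key, h2]
    · have heb : e ∈ b := by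
        have := @hx e (by simp)
        simpa [hea] using this
      obtain ⟨b₁, b₂, rfl⟩ := List.append_of_mem heb
      obtain ⟨hb₁, hb₂⟩ := isPath_append_cons.1 hb
      have key := ih (a ++ (b₁ ++ [e])) b₂ (y ++ [e]) (tgt e)
        (ha.append (isPath_append_cons.2 ⟨hb₁, rfl⟩)) hrot hb₂
        (by intro t ht; have := @hy t; grind)
        (by intro t ht; have := @hx t; grind)
      have h1 := h.comm (e :: b₂) ha hloop hb₁
      simp only [List.append_assoc, List.cons_append, List.nil_append] at *
      rw [h1, key]

theorem val_eq_of_prefix (h : LoopSemilattice src tgt p val) {q : V} (v : List E) :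
    ∀ (c u : List E) (r : V), IsPath src tgt p c r → IsPath src tgt r u q →
      IsPath src tgt r v q → (∀ e, e ∈ c ++ u ↔ e ∈ c ++ v) →
      val (c ++ u) = val (c ++ v) := by
  induction v with
  | nil =>
    intro c u r hc hu hv hs
    obtain rfl : r = q := hv
    have := h.absorb hc hu (fun e he => by have := hs e; simp at this; tauto) []
    simpa using this
  | cons e v ih =>
    intro c u r hc hu hv hs
    obtain ⟨rfl, hv⟩ := hv
    have hc' : IsPath src tgt p (c ++ [e]) (tgt e) := isPath_append_cons.2 ⟨hc, rfl⟩
    have hinsert : ∀ l, IsPath src tgt (tgt e) l (src e) → l ⊆ c ++ u →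
        val (c ++ u) = val (c ++ e :: v) := by
      intro l hl hsub
      have he : e ∈ c ++ u := (hs e).2 (by simp)
      have h1 := h.absorb_split (e :: l) c u [] (src e) hc
        (by simpa using hl.cons) hu (by simp)
        (by simpa using ⟨by simpa using he, hsub⟩)
      have h2 := ih (c ++ [e]) (l ++ u) (tgt e) hc' (hl.append hu) hv (by
        intro t
        have := hs t
        have := @hsub t
        grind)
      simp only [List.append_assoc, List.cons_append, List.nil_append] at h1 h2
      rw [← h1, h2]
    by_cases hec : e ∈ c
    · obtain ⟨c₁, c₂, rfl⟩ := List.append_of_mem hec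
      exact hinsert c₂ (isPath_append_cons.1 hc).2 (by intro t ht; simp [ht])
    have heu : e ∈ u := by
      have := (hs e).2 (by simp)
      simpa [hec] using this
    obtain ⟨x, y, rfl⟩ := List.append_of_mem heu
    obtain ⟨hx, hy⟩ := isPath_append_cons.1 hu
    by_cases hxc : x ⊆ c
    · have h1 := h.absorb hc hx hxc (e :: y)
      have h2 := ih (c ++ [e]) y (tgt e) hc' hy hv (by
        intro t
        have := hs t
        have := @hxc t
        grind)
      simp only [List.append_assoc, List.cons_append, List.nil_append] at h1 h2
      rw [h1, h2]
    obtain ⟨f, hfx, hfc⟩ : ∃ f, f ∈ x ∧ f ∉ c := by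
      simpa [List.subset_def] using hxc
    obtain ⟨x₁, x₂, rfl⟩ := List.append_of_mem hfx
    have hx₂ := (isPath_append_cons.1 hx).2
    rcases List.mem_cons.1 (by simpa [hfc] using (hs f).1 (by simp) : f ∈ e :: v) with rfl | hfv
    · exact hinsert x₂ hx₂ (by intro t ht; simp [ht])
    · obtain ⟨v₁, v₂, rfl⟩ := List.append_of_mem hfv
      obtain ⟨hv₁, -⟩ := isPath_append_cons.1 hv
      refine hinsert (v₁ ++ f :: x₂) (isPath_append_cons.2 ⟨hv₁, hx₂⟩) ?_
      intro t ht
      have := hs t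
      grind

/-- Coterminal paths with the same set of edges have the same value. -/
theorem val_eq (h : LoopSemilattice src tgt p val) {q : V} {u v : List E}
    (hu : IsPath src tgt p u q) (hv : IsPath src tgt p v q) (hs : ∀ e, e ∈ u ↔ e ∈ v) :
    val u = val v :=
  h.val_eq_of_prefix v [] u p rfl hu hv hs

end LoopSemilattice

end Paths

section DeBruijn

variable {A : Type*}

/-- Target of the edge `(x, a)` of the de Bruijn graph. -/
def shiftTarget (e : List A × A) : List A := (e.1 ++ [e.2]).drop 1

/-- The path in the de Bruijn graph which starts at `x` and reads the given word. -/
def wordPath : List A → List A → List (List A × A)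
  | _, [] => []
  | x, a :: w => (x, a) :: wordPath (shiftTarget (x, a)) w

theorem length_shiftTarget (e : List A × A) : (shiftTarget e).length = e.1.length := by
  simp [shiftTarget]

theorem exists_cons_shiftTarget (x : List A) (a : A) :
    ∃ c, ∀ w, x ++ a :: w = c :: (shiftTarget (x, a) ++ w) := by
  cases x with
  | nil => exact ⟨a, fun w => by simp [shiftTarget]⟩
  | cons c x => exact ⟨c, fun w => by simp [shiftTarget]⟩

theorem map_snd_wordPath (x w : List A) : (wordPath x w).map Prod.snd = w := by
  induction w generalizing x with
  | nil => rfl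
  | cons a w ih => simp [wordPath, ih]

theorem isPath_wordPath (x w : List A) :
    IsPath Prod.fst shiftTarget x (wordPath x w) ((x ++ w).drop w.length) := by
  induction w generalizing x with
  | nil => simp [wordPath, IsPath]
  | cons a w ih =>
    obtain ⟨c, hc⟩ := exists_cons_shiftTarget x a
    have := ih (shiftTarget (x, a))
    simpa [wordPath, IsPath, hc] using this

theorem IsPath.exists_append_eq {x y : List A} {l : List (List A × A)}
    (h : IsPath Prod.fst shiftTarget x l y) : ∃ w, x ++ l.map Prod.snd = w ++ y := by
  induction l generalizing x with
  | nil =>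
    obtain rfl : x = y := h
    exact ⟨[], by simp⟩
  | cons e l ih =>
    obtain ⟨rfl, h⟩ := h
    obtain ⟨w, hw⟩ := ih h
    obtain ⟨c, hc⟩ := exists_cons_shiftTarget e.1 e.2
    exact ⟨c :: w, by simp [hc, hw]⟩

theorem IsPath.length_eq {x y : List A} {l : List (List A × A)}
    (h : IsPath Prod.fst shiftTarget x l y) : y.length = x.length := by
  induction l generalizing x with
  | nil => exact congrArg List.length (h : x = y).symm
  | cons e l ih =>
    obtain ⟨rfl, h⟩ := h
    rw [ih h, length_shiftTarget]

theorem mem_wordPath {x w y : List A} {a : A} :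
    (y, a) ∈ wordPath x w ↔ y.length = x.length ∧ y ++ [a] <:+: x ++ w := by
  induction w generalizing x with
  | nil =>
    simp only [wordPath, List.not_mem_nil, List.append_nil, false_iff, not_and]
    intro h h'
    have := h'.length_le
    simp at this
    omega
  | cons b w ih =>
    obtain ⟨c, hc⟩ := exists_cons_shiftTarget x b
    rw [wordPath, List.mem_cons, ih, hc, List.infix_cons_iff, length_shiftTarget, ← hc]
    have key : (y, a) = (x, b) ↔ y.length = x.length ∧ y ++ [a] <+: x ++ b :: w := by
      constructor
      · rintro ⟨⟩
        exact ⟨rfl, w, by simp⟩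
      · rintro ⟨hl, t, ht⟩
        rw [List.append_assoc] at ht
        obtain ⟨rfl, h2⟩ := List.append_inj ht hl
        simp at h2
        simp [h2]
    rw [key]
    tauto

end DeBruijn

section Automaton

variable {Q A : Type*} {δ : Q → A → Q}

theorem deltaStar_append (q : Q) (u v : List A) :
    deltaStar δ q (u ++ v) = deltaStar δ (deltaStar δ q u) v :=
  List.foldl_append

theorem reach_deltaStar (q : Q) (w : List A) : Reach δ q (deltaStar δ q w) := ⟨w, rfl⟩

theorem Reach.of_append {p q : Q} {u v : List A} (h : Reach δ (deltaStar δ p (u ++ v)) q) :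
    Reach δ (deltaStar δ p u) q := by
  obtain ⟨w, hw⟩ := h
  exact ⟨v ++ w, by rw [deltaStar_append, ← deltaStar_append p, hw]⟩

/-- The graph conditions characterizing local testability. -/
def GraphConditions (δ : Q → A → Q) : Prop :=
  ∀ p q : Q, CNode δ p q → Reach δ p q →
    ((Reach δ q p → p = q) ∧
      ∀ f ∈ TransSemigroup δ, (Reach δ (f p) q ↔ Reach δ (f q) q))

theorem GraphConditions.reach_iff (h : GraphConditions δ) {p q : Q} (hC : CNode δ p q)
    (hpq : Reach δ p q) (w : List A) :
    Reach δ (deltaStar δ p w) q ↔ Reach δ (deltaStar δ q w) q := by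
  by_cases hw : w = []
  · subst hw
    exact ⟨fun _ => ⟨[], rfl⟩, fun _ => hpq⟩
  · exact (h p q hC hpq).2 (fun q => deltaStar δ q w) ⟨w, hw, fun _ => rfl⟩

theorem GraphConditions.deltaStar_idem (h : GraphConditions δ) {P : Set Q}
    (hP : ∀ p ∈ P, ∀ q ∈ P, CNode δ p q) {r : List A} (hr : ∀ p ∈ P, deltaStar δ p r ∈ P)
    {p : Q} (hp : p ∈ P) :
    deltaStar δ (deltaStar δ p r) r = deltaStar δ p r := by
  have h1 := (h.reach_iff (hP p hp _ (hr p hp)) (reach_deltaStar p r) r).1 ⟨[], rfl⟩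
  exact ((h _ _ (hP _ (hr p hp) _ (hr _ (hr p hp))) (reach_deltaStar _ r)).1 h1).symm

theorem GraphConditions.deltaStar_comm (h : GraphConditions δ) {P : Set Q}
    (hP : ∀ p ∈ P, ∀ q ∈ P, CNode δ p q) {r t : List A} (hr : ∀ p ∈ P, deltaStar δ p r ∈ P)
    (ht : ∀ p ∈ P, deltaStar δ p t ∈ P) {p : Q} (hp : p ∈ P) :
    deltaStar δ (deltaStar δ p r) t = deltaStar δ (deltaStar δ p t) r := by
  have key : ∀ r t : List A, (∀ p ∈ P, deltaStar δ p r ∈ P) → (∀ p ∈ P, deltaStar δ p t ∈ P) →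
      Reach δ (deltaStar δ p (t ++ r)) (deltaStar δ p (r ++ t)) := by
    intro r t hr ht
    have ha : deltaStar δ p (r ++ t) ∈ P := by
      rw [deltaStar_append]
      exact ht _ (hr _ hp)
    set a := deltaStar δ p (r ++ t) with ha_def
    have hat : deltaStar δ a t = a := by
      rw [ha_def, deltaStar_append, h.deltaStar_idem hP ht (hr p hp)]
    have hpa : CNode δ p a := hP p hp a ha
    have hra : Reach δ p a := reach_deltaStar p _
    have har : deltaStar δ a r = a := by
      have h1 : Reach δ (deltaStar δ a r) a :=
        ((h.reach_iff hpa hra (r ++ t)).1 ⟨[], rfl⟩).of_append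
      exact ((h _ _ (hP _ ha _ (hr _ ha)) (reach_deltaStar a r)).1 h1).symm
    refine (h.reach_iff hpa hra (t ++ r)).2 ?_
    rw [deltaStar_append, hat, har]
    exact ⟨[], rfl⟩
  rw [← deltaStar_append, ← deltaStar_append]
  have hmem : ∀ r t : List A, (∀ p ∈ P, deltaStar δ p r ∈ P) → (∀ p ∈ P, deltaStar δ p t ∈ P) →
      deltaStar δ p (r ++ t) ∈ P := by
    intro r t hr ht
    rw [deltaStar_append]
    exact ht _ (hr _ hp)
  exact (h _ _ (hP _ (hmem r t hr ht) _ (hmem t r ht hr)) (key t r ht hr)).1 (key r t hr ht)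

/-- A long enough word has a prefix all of whose target states are fixed by one nonempty word. -/
theorem exists_prefix_fixed [Fintype Q] [DecidableEq Q] (δ : Q → A → Q) {x : List A}
    (hx : Fintype.card (Q → Q) ≤ x.length) :
    ∃ y z g : List A, x = y ++ z ∧ g ≠ [] ∧
      ∀ q, deltaStar δ (deltaStar δ q y) g = deltaStar δ q y := by
  obtain ⟨i, j, hij, hf⟩ : ∃ i j : Fin (x.length + 1), i < j ∧
      (fun q => deltaStar δ q (x.take i)) = fun q => deltaStar δ q (x.take j) := by
    obtain ⟨i, j, hne, hf⟩ := Fintype.exists_ne_map_eq_of_card_lt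
      (fun (i : Fin (x.length + 1)) (q : Q) => deltaStar δ q (x.take i))
      (by simpa [Nat.lt_succ_iff] using hx)
    rcases lt_or_gt_of_ne hne with h | h
    · exact ⟨i, j, h, hf⟩
    · exact ⟨j, i, h, hf.symm⟩
  have hij' : (i : ℕ) < j := hij
  have hj : (j : ℕ) ≤ x.length := Nat.lt_succ_iff.1 j.2
  have hsplit : x.take j = x.take i ++ (x.take j).drop i := by
    conv_lhs => rw [← List.take_append_drop i (x.take j)]
    rw [List.take_take, min_eq_left hij'.le]
  refine ⟨x.take i, x.drop i, (x.take j).drop i, (List.take_append_drop _ _).symm, ?_, ?_⟩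
  · apply List.ne_nil_of_length_pos
    simp
    omega
  · intro q
    rw [← deltaStar_append, ← hsplit]
    exact (congrFun hf q).symm

theorem exists_conjugate {y z X s : List A} (h : y ++ z ++ X = s ++ (y ++ z)) :
    ∃ r, z ++ X = r ++ z ∧ y ++ r = s ++ y := by
  have h1 : y <+: s ++ y := by
    refine List.prefix_of_prefix_length_le (l₃ := y ++ z ++ X) ⟨z ++ X, by simp⟩ ⟨z, ?_⟩ (by simp)
    simp [h]
  obtain ⟨r, hr⟩ := h1
  refine ⟨r, ?_, hr⟩
  have : y ++ (z ++ X) = y ++ (r ++ z) := by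
    rw [← List.append_assoc, h, ← List.append_assoc, ← hr, List.append_assoc]
  exact List.append_cancel_left this

theorem GraphConditions.loopSemilattice [Fintype Q] [DecidableEq Q] (h : GraphConditions δ)
    (q₀ : Q) {x : List A} (hx : x.length = Fintype.card (Q → Q)) :
    LoopSemilattice Prod.fst shiftTarget x
      (fun l => deltaStar δ q₀ (x ++ l.map Prod.snd)) := by
  have main : ∀ {v : List A} {a : List (List A × A)}, IsPath Prod.fst shiftTarget x a v →
      ∃ (P : Set Q) (p : Q) (z : List A), (∀ p ∈ P, ∀ q ∈ P, CNode δ p q) ∧ p ∈ P ∧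
        (∀ w, deltaStar δ q₀ (x ++ (a.map Prod.snd ++ w)) = deltaStar δ p (z ++ w)) ∧
        ∀ l, IsPath Prod.fst shiftTarget v l v →
          ∃ r, z ++ l.map Prod.snd = r ++ z ∧ ∀ p ∈ P, deltaStar δ p r ∈ P := by
    intro v a ha
    obtain ⟨y, z, g, rfl, hg, hfix⟩ := exists_prefix_fixed δ (ha.length_eq.trans hx).ge
    obtain ⟨s, hs⟩ := ha.exists_append_eq
    refine ⟨Set.range fun q => deltaStar δ q y, _, z, ?_, ⟨deltaStar δ q₀ s, rfl⟩, ?_, ?_⟩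
    · rintro _ ⟨p, rfl⟩ _ ⟨q, rfl⟩
      exact ⟨g, hg, hfix p, hfix q⟩
    · intro w
      rw [← List.append_assoc, hs]
      simp [deltaStar_append]
    · intro l hl
      obtain ⟨t, ht⟩ := hl.exists_append_eq
      obtain ⟨r, hr, hyr⟩ := exists_conjugate ht
      refine ⟨r, hr, ?_⟩
      rintro _ ⟨q, rfl⟩
      refine ⟨deltaStar δ q t, ?_⟩
      simp only
      rw [← deltaStar_append, ← deltaStar_append, hyr]
  constructor
  · intro v a l b ha hl
    obtain ⟨P, p, z, hP, hp, hval, hloop⟩ := main ha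
    obtain ⟨r, hr, hrP⟩ := hloop l hl
    have hr' : ∀ w, z ++ (l.map Prod.snd ++ w) = r ++ (z ++ w) := fun w => by
      rw [← List.append_assoc, hr, List.append_assoc]
    simp only [List.map_append, hval, hr', deltaStar_append p r, deltaStar_append _ r,
      h.deltaStar_idem hP hrP hp]
  · intro v a l k b ha hl hk
    obtain ⟨P, p, z, hP, hp, hval, hloop⟩ := main ha
    obtain ⟨r, hr, hrP⟩ := hloop l hl
    obtain ⟨t, ht, htP⟩ := hloop k hk
    have hr' : ∀ w, z ++ (l.map Prod.snd ++ w) = r ++ (z ++ w) := fun w => by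
      rw [← List.append_assoc, hr, List.append_assoc]
    have ht' : ∀ w, z ++ (k.map Prod.snd ++ w) = t ++ (z ++ w) := fun w => by
      rw [← List.append_assoc, ht, List.append_assoc]
    simp only [List.map_append, hval, hr', ht', deltaStar_append _ r, deltaStar_append _ t,
      h.deltaStar_comm hP hrP htP hp]

theorem GraphConditions.deltaStar_eq [Fintype Q] [DecidableEq Q] (h : GraphConditions δ) (q₀ : Q)
    {m : ℕ} (hm : m = Fintype.card (Q → Q)) {u v : List A}
    (hu : m ≤ u.length) (htake : u.take m = v.take m)
    (hdrop : u.drop (u.length - m) = v.drop (v.length - m))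
    (hfac : ∀ f : List A, f.length = m + 1 → (f <:+: u ↔ f <:+: v)) :
    deltaStar δ q₀ u = deltaStar δ q₀ v := by
  have hx : (u.take m).length = m := by simpa using hu
  have hu' : u.take m ++ u.drop m = u := List.take_append_drop m u
  have hv' : u.take m ++ v.drop m = v := by rw [htake, List.take_append_drop]
  have hpu := isPath_wordPath (u.take m) (u.drop m)
  have hpv := isPath_wordPath (u.take m) (v.drop m)
  rw [hu', List.length_drop, hdrop] at hpu
  rw [hv', List.length_drop] at hpv
  have := (h.loopSemilattice q₀ (hx.trans hm)).val_eq hpu hpv (by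
    rintro ⟨y, a⟩
    rw [mem_wordPath, mem_wordPath, hu', hv', hx]
    exact and_congr_right fun hy => hfac _ (by simp [hy]))
  simpa only [map_snd_wordPath, hu', hv'] using this

theorem GraphConditions.locallyTestable [Fintype Q] (h : GraphConditions δ) (q₀ : Q)
    (F : Set Q) : LocallyTestable {w : List A | w ≠ [] ∧ deltaStar δ q₀ w ∈ F} := by
  classical
  refine ⟨Fintype.card (Q → Q) + 1, by omega, ?_⟩
  set m := Fintype.card (Q → Q) with hm
  intro u v hu hv htake hdrop hfac
  simp only [Nat.add_sub_cancel] at htake hdrop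
  have hlong : ∀ {u v : List A}, (∀ f : List A, f.length = m + 1 → (f <:+: u ↔ f <:+: v)) →
      m < u.length → m < v.length := by
    intro u v hfac h
    have h1 := (hfac (u.take (m + 1)) (by simpa using h)).1 (List.take_prefix _ _).isInfix
    have h2 := h1.length_le
    rw [List.length_take] at h2
    omega
  have key : deltaStar δ q₀ u = deltaStar δ q₀ v := by
    rcases lt_or_ge m u.length with hlu | hlu
    · exact h.deltaStar_eq q₀ hm hlu.le htake hdrop hfac
    · have hlv : v.length ≤ m := by
        by_contra hlv
        have := hlong (fun f hf => (hfac f hf).symm) (not_le.1 hlv)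
        omega
      rw [List.take_of_length_le hlu, List.take_of_length_le hlv] at htake
      rw [htake]
  simp only [Set.mem_ofPred_eq, ne_eq, hu, hv, not_false_eq_true, true_and, key]

end Automaton

section Testable

variable {Q A : Type*} {δ : Q → A → Q}

theorem infix_append_append_iff {f a e b : List A} (h : f.length ≤ e.length) :
    f <:+: a ++ (e ++ b) ↔ f <:+: a ++ e ∨ f <:+: e ++ b := by
  constructor
  · intro hf
    rcases List.infix_append_iff.1 hf with hf | hf | ⟨s, t, rfl, hs, ht⟩
    · exact Or.inl (hf.trans (List.prefix_append _ _).isInfix)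
    · exact Or.inr hf
    · left
      have hte : t <+: e :=
        List.prefix_of_prefix_length_le ht (List.prefix_append _ _) (by simp at h; omega)
      exact List.infix_append_iff.2 (Or.inr (Or.inr ⟨s, t, rfl, hs, hte⟩))
  · rintro (hf | hf)
    · exact hf.trans ⟨[], b, by simp⟩
    · exact hf.trans (List.suffix_append _ _).isInfix

theorem KTestable.mem_iff {L : Set (List A)} {k : ℕ} (hk : 1 ≤ k) (hL : KTestable L k)
    {e x z u v : List A} (he : k ≤ e.length)
    (hfac : ∀ f : List A, f.length ≤ e.length →
      (f <:+: e ++ (u ++ e) ↔ f <:+: e ++ (v ++ e))) :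
    x ++ (e ++ (u ++ (e ++ z))) ∈ L ↔ x ++ (e ++ (v ++ (e ++ z))) ∈ L := by
  have hne : e ≠ [] := by
    rintro rfl
    simp at he
    omega
  refine hL _ _ (by simp [hne]) (by simp [hne]) ?_ ?_ ?_
  · have key : ∀ w : List A, (x ++ (e ++ w)).take (k - 1) = (x ++ e).take (k - 1) := fun w => by
      rw [← List.append_assoc, List.take_append_of_le_length (by simp; omega)]
    rw [key, key]
  · have key : ∀ w : List A, (x ++ (e ++ (w ++ (e ++ z)))).drop
        ((x ++ (e ++ (w ++ (e ++ z)))).length - (k - 1)) =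
        (e ++ z).drop ((e ++ z).length - (k - 1)) := by
      intro w
      have h1 : x ++ (e ++ (w ++ (e ++ z))) = (x ++ (e ++ w)) ++ (e ++ z) := by simp
      rw [h1, List.drop_append, List.drop_eq_nil_of_le (by simp; omega), List.nil_append]
      congr 1
      simp
      omega
    rw [key, key]
  · intro f hf
    have hfe : f.length ≤ e.length := by omega
    have key : ∀ w : List A, f <:+: x ++ (e ++ (w ++ (e ++ z))) ↔
        f <:+: x ++ e ∨ f <:+: e ++ (w ++ e) ∨ f <:+: e ++ z := by
      intro w
      have h1 := infix_append_append_iff (a := e ++ w) (b := z) hfe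
      rw [infix_append_append_iff hfe, ← List.append_assoc e w, h1, List.append_assoc]
    rw [key, key, hfac f hfe]

theorem infix_square_iff {f e s : List A} (h : f.length ≤ e.length) :
    f <:+: e ++ ((s ++ (e ++ s)) ++ e) ↔ f <:+: e ++ (s ++ e) := by
  have h1 := infix_append_append_iff (a := e ++ s) (b := s ++ e) h
  simp only [List.append_assoc] at h1 ⊢
  rw [h1, or_self]

theorem infix_swap_iff {f e s t : List A} (h : f.length ≤ e.length) :
    f <:+: e ++ ((s ++ (e ++ t)) ++ e) ↔ f <:+: e ++ ((t ++ (e ++ s)) ++ e) := by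
  have h1 := infix_append_append_iff (a := e ++ s) (b := t ++ e) h
  have h2 := infix_append_append_iff (a := e ++ t) (b := s ++ e) h
  simp only [List.append_assoc] at h1 h2 ⊢
  rw [h1, h2, or_comm]

theorem exists_long_fixing_word {p q : Q} (h : CNode δ p q) (k : ℕ) :
    ∃ e : List A, k ≤ e.length ∧ deltaStar δ p e = p ∧ deltaStar δ q e = q := by
  obtain ⟨w, hw, hp, hq⟩ := h
  induction k with
  | zero => exact ⟨[], le_rfl, rfl, rfl⟩
  | succ k ih =>
    obtain ⟨e, hk, hpe, hqe⟩ := ih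
    refine ⟨w ++ e, ?_, by rw [deltaStar_append, hp, hpe], by rw [deltaStar_append, hq, hqe]⟩
    have := List.length_pos_of_ne_nil hw
    simp
    omega

theorem graphConditions_of_locallyTestable {q₀ : Q} {F : Set Q}
    (hreach : ∀ q : Q, Reach δ q₀ q)
    (hdist : ∀ p q : Q, p ≠ q → ∃ w : List A, ¬(deltaStar δ p w ∈ F ↔ deltaStar δ q w ∈ F))
    (hL : LocallyTestable {w : List A | w ≠ [] ∧ deltaStar δ q₀ w ∈ F}) :
    GraphConditions δ := by
  obtain ⟨k, hk, hL⟩ := hL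
  intro p q hC hpq
  obtain ⟨e, hke, hpe, hqe⟩ := exists_long_fixing_word hC k
  have hne : e ≠ [] := by
    rintro rfl
    simp at hke
    omega
  have lift : ∀ u v : List A, (∀ f : List A, f.length ≤ e.length →
      (f <:+: e ++ (u ++ e) ↔ f <:+: e ++ (v ++ e))) →
      ∀ o, deltaStar δ o e = o →
        deltaStar δ o (u ++ e) = deltaStar δ o (v ++ e) := by
    intro u v hfac o ho
    by_contra hcon
    obtain ⟨z, hz⟩ := hdist _ _ hcon
    obtain ⟨x, rfl⟩ := hreach o
    have := hL.mem_iff hk (x := x) (z := z) hke hfac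
    simp only [Set.mem_ofPred_eq, ne_eq, List.append_eq_nil_iff, hne, false_and, and_false,
      not_false_eq_true, true_and, deltaStar_append, ho] at this
    simp only [deltaStar_append] at hz
    exact hz this
  have idem : ∀ s o, deltaStar δ o e = o →
      deltaStar δ (deltaStar δ (deltaStar δ (deltaStar δ o s) e) s) e =
        deltaStar δ (deltaStar δ o s) e := by
    intro s o ho
    have := lift (s ++ (e ++ s)) s (fun f hf => infix_square_iff hf) o ho
    simpa only [deltaStar_append] using this
  have comm : ∀ s t o, deltaStar δ o e = o →
      deltaStar δ (deltaStar δ (deltaStar δ (deltaStar δ o s) e) t) e =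
        deltaStar δ (deltaStar δ (deltaStar δ (deltaStar δ o t) e) s) e := by
    intro s t o ho
    have := lift (s ++ (e ++ t)) (t ++ (e ++ s)) (fun f hf => infix_swap_iff hf) o ho
    simpa only [deltaStar_append] using this
  obtain ⟨a, ha⟩ := hpq
  constructor
  · rintro ⟨b, hb⟩
    have h1 := idem a p hpe
    have h2 := idem b q hqe
    have h3 := comm a b p hpe
    rw [ha, hqe] at h1 h3
    rw [hb, hpe] at h2 h3
    rw [h2, ha, hqe] at h3
    exact h3
  · rintro f ⟨s, -, hf⟩
    rw [hf, hf]
    constructor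
    · rintro ⟨t, ht⟩
      have h1 := idem (s ++ t) p hpe
      rw [deltaStar_append p, ht, hqe] at h1
      exact ⟨t ++ e, by simpa only [deltaStar_append] using h1⟩
    · rintro ⟨t, ht⟩
      have h1 := comm (s ++ t) a p hpe
      rw [ha, hqe, deltaStar_append q, ht, hqe] at h1
      exact ⟨t ++ (e ++ (a ++ e)), by simpa only [deltaStar_append] using h1⟩

end Testable

/-- Kim–McNaughton–McCloskey criterion: a reduced complete DFA is locally testable
iff for every C-node `(p,q)` of `Γ²` with `p ⪰ q`:
(1) if moreover `q ⪰ p` then `p = q`; and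
(2) for every `s` in the transition semigroup, `p·s ⪰ q ↔ q·s ⪰ q`. -/
theorem locally_testable_iff_graph_conditions
    {Q A : Type*} [Fintype Q] [Fintype A]
    (δ : Q → A → Q) (q0 : Q) (Fset : Set Q)
    (hreach : ∀ q : Q, Reach δ q0 q)
    (hdist : ∀ p q : Q, p ≠ q →
      ∃ w : List A, ¬(deltaStar δ p w ∈ Fset ↔ deltaStar δ q w ∈ Fset)) :
    LocallyTestable {w : List A | w ≠ [] ∧ deltaStar δ q0 w ∈ Fset} ↔
      ∀ p q : Q, CNode δ p q → Reach δ p q →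
        ((Reach δ q p → p = q) ∧
          ∀ f ∈ TransSemigroup δ, (Reach δ (f p) q ↔ Reach δ (f q) q)) :=
  ⟨graphConditions_of_locallyTestable hreach hdist,
    fun h => GraphConditions.locallyTestable h q0 Fset⟩
end

section
/- Let A be a complete deterministic finite automaton over a finite alphabet with finite state set, transition graph Γ and transition semigroup S. Suppose S is aperiodic and for every idempotent e ∈ S the subsemigroup eSe is commutative and idempotent. Then for every C-node (p,q) of Γ² with p ⪰ q and q ⪰ p, one has p = q. -/
theorem TransSemigroup.comp_mem {Q A : Type*} {δ : Q → A → Q} {f g : Q → Q}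
    (hf : f ∈ TransSemigroup δ) (hg : g ∈ TransSemigroup δ) : g ∘ f ∈ TransSemigroup δ := by
  obtain ⟨u, hu, hfu⟩ := hf
  obtain ⟨v, -, hgv⟩ := hg
  refine ⟨u ++ v, by simp [hu], fun q => ?_⟩
  simp only [Function.comp_apply, hgv, hfu, deltaStar, List.foldl_append]

theorem TransSemigroup.iterate_succ_mem {Q A : Type*} {δ : Q → A → Q} {f : Q → Q}
    (hf : f ∈ TransSemigroup δ) (n : ℕ) : f^[n + 1] ∈ TransSemigroup δ := by
  induction n with
  | zero => simpa using hf
  | succ n ih =>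
    rw [Function.iterate_succ]
    exact TransSemigroup.comp_mem hf ih

theorem iterate_comp_self_of_iterate_eq_succ {Q : Type*} {f : Q → Q} {n : ℕ}
    (h : f^[n] = f^[n + 1]) : f^[n] ∘ f^[n] = f^[n] := by
  have absorb : ∀ k : ℕ, f^[k] ∘ f^[n] = f^[n] := by
    intro k
    induction k with
    | zero => rfl
    | succ k ih =>
      rw [Function.iterate_succ, Function.comp_assoc, ← Function.iterate_succ', ← h, ih]
  exact absorb n

/-- If the transition semigroup `S` is aperiodic and `eSe` is commutative and
idempotent for every idempotent `e ∈ S`, then every C-node `(p,q)` of `Γ²` with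
`p ⪰ q` and `q ⪰ p` satisfies `p = q`.
(Here the element `e∘s∘e : Q → Q` is the transformation `ese` of the right
action, and `f^[n]` is the `n`-th semigroup power of `f`.) -/
theorem cnode_mutually_reachable_eq
    {Q A : Type*} [Fintype Q] [Fintype A] (δ : Q → A → Q)
    (haper : ∀ f ∈ TransSemigroup δ, ∃ n ≥ 1, f^[n] = f^[n + 1])
    (hloc : ∀ e ∈ TransSemigroup δ, e ∘ e = e →
      ∀ s ∈ TransSemigroup δ,
        ((e ∘ s ∘ e) ∘ (e ∘ s ∘ e) = e ∘ s ∘ e ∧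
          ∀ t ∈ TransSemigroup δ,
            (e ∘ s ∘ e) ∘ (e ∘ t ∘ e) = (e ∘ t ∘ e) ∘ (e ∘ s ∘ e))) :
    ∀ p q : Q, CNode δ p q → Reach δ p q → Reach δ q p → p = q := by
  rintro p q ⟨w, hw, hwp, hwq⟩ ⟨u, hu⟩ ⟨v, hv⟩
  rcases eq_or_ne u [] with rfl | hu0
  · exact hu
  rcases eq_or_ne v [] with rfl | hv0
  · exact hv.symm
  have hf : (fun x => deltaStar δ x w) ∈ TransSemigroup δ := ⟨w, hw, fun _ => rfl⟩
  have hs : (fun x => deltaStar δ x u) ∈ TransSemigroup δ := ⟨u, hu0, fun _ => rfl⟩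
  have ht : (fun x => deltaStar δ x v) ∈ TransSemigroup δ := ⟨v, hv0, fun _ => rfl⟩
  obtain ⟨n, hn, hfn⟩ := haper _ hf
  obtain ⟨m, rfl⟩ := Nat.exists_eq_add_of_le' hn
  have he := TransSemigroup.iterate_succ_mem hf m
  have hee := iterate_comp_self_of_iterate_eq_succ hfn
  have hep := Function.iterate_fixed (f := fun x => deltaStar δ x w) hwp (m + 1)
  have heq := Function.iterate_fixed (f := fun x => deltaStar δ x w) hwq (m + 1)
  generalize (fun x => deltaStar δ x w)^[m + 1] = e at he hee hep heq
  obtain ⟨ha, hcomm⟩ := hloc e he hee _ hs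
  have hab := congrFun (hcomm _ ht) q
  have haq := congrFun ha p
  simp only [Function.comp_apply, hep, heq, hu] at haq
  simp only [Function.comp_apply, hep, heq, hu, hv, haq] at hab
  exact hab.symm
end

section
/- Let A be a complete deterministic finite automaton over a finite alphabet with finite state set, transition graph Γ and transition semigroup S. Suppose that (1) for every C-node (p,q) of Γ² with p ⪰ q and q ⪰ p one has p = q, and (2) for every C-node (p,q) of Γ² with p ⪰ q and every s ∈ S, p·s ⪰ q if and only if q·s ⪰ q. Then for every idempotent e ∈ S and every s ∈ S, the element ese is idempotent: (ese)² = ese (equality of transformations of the state set). -/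
/-- If (1) every C-node `(p,q)` of `Γ²` with `p ⪰ q` and `q ⪰ p` satisfies `p = q`
and (2) for every C-node `(p,q)` of `Γ²` with `p ⪰ q` and every `s ∈ S` one has
`p·s ⪰ q ↔ q·s ⪰ q`, then for every idempotent `e ∈ S` and every `s ∈ S` the
transformation `ese` (i.e. `e ∘ s ∘ e`) is idempotent. -/
theorem ese_idempotent_of_graph_conditions
    {Q A : Type*} [Fintype Q] [Fintype A] (δ : Q → A → Q)
    (h1 : ∀ p q : Q, CNode δ p q → Reach δ p q → Reach δ q p → p = q)
    (h2 : ∀ p q : Q, CNode δ p q → Reach δ p q →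
      ∀ f ∈ TransSemigroup δ, (Reach δ (f p) q ↔ Reach δ (f q) q)) :
    ∀ e ∈ TransSemigroup δ, e ∘ e = e →
      ∀ s ∈ TransSemigroup δ, (e ∘ s ∘ e) ∘ (e ∘ s ∘ e) = e ∘ s ∘ e := by
  rintro e ⟨u, hu, he⟩ hee s ⟨v, -, hs⟩
  have idem : ∀ x, e (e x) = e x := fun x => congrFun hee x
  have hf : ∀ x, e (s (e x)) = deltaStar δ x (u ++ (v ++ u)) := fun x => by
    rw [he (s (e x)), hs (e x), he x]
    simp [deltaStar]
  have node : ∀ x y, e x = x → e y = y → CNode δ x y := fun x y hx hy =>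
    ⟨u, hu, by rw [← he, hx], by rw [← he, hy]⟩
  have reach : ∀ x, Reach δ x (e (s (e x))) := fun x => ⟨_, (hf x).symm⟩
  have mem : e ∘ s ∘ e ∈ TransSemigroup δ := ⟨u ++ (v ++ u), by simp [hu], hf⟩
  funext p
  have hpq : Reach δ (e p) (e (s (e p))) := by simpa only [idem] using reach (e p)
  have back : Reach δ (e (s (e (e (s (e p)))))) (e (s (e p))) :=
    (h2 _ _ (node _ _ (idem p) (idem _)) hpq _ mem).1 ⟨[], by simp [deltaStar, idem]⟩
  exact (h1 _ _ (node _ _ (idem _) (idem _)) (reach _) back).symm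
end

section
/- For a finite semigroup S the following conditions are equivalent: (a) for every idempotent e ∈ S, the subsemigroup eSe is commutative and idempotent; (b) for every idempotent e ∈ S, the subsemigroup Se satisfies the identities of 2-testability; (c) for every idempotent e ∈ S, the subsemigroup eS satisfies the identities of 2-testability; (d) for every idempotent e ∈ S, the subsemigroup SeS satisfies the identities of 2-testability. -/
/-- A subset `T` of a semigroup satisfies the identities of 2-testability:
`x² = x³`, `xyx = xyxyx` and `xyxzx = xzxyx` for all `x, y, z ∈ T`. -/
def TwoTestable {S : Type*} [Semigroup S] (T : Set S) : Prop :=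
  ∀ x ∈ T, ∀ y ∈ T, ∀ z ∈ T,
    x * x = x * x * x ∧
    x * y * x = x * y * x * y * x ∧
    x * y * x * z * x = x * z * x * y * x

theorem TwoTestable.mono {S : Type*} [Semigroup S] {T U : Set S} (hU : TwoTestable U)
    (h : T ⊆ U) : TwoTestable T :=
  fun x hx y hy z hz => hU x (h hx) y (h hy) z (h hz)

/-- If a 2-testable set contains `eSe`, then `eSe` is idempotent and commutative. -/
theorem TwoTestable.local_semilattice {S : Type*} [Semigroup S] {T : Set S} (hT : TwoTestable T)
    {e : S} (he : e * e = e) (h : ∀ s, e * s * e ∈ T) (s t : S) :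
    (e * s * e) * (e * s * e) = e * s * e ∧
      (e * s * e) * (e * t * e) = (e * t * e) * (e * s * e) := by
  have heT : e ∈ T := by simpa [he] using h e
  have hl (a : S) : e * (e * a) = e * a := by rw [← mul_assoc, he]
  obtain ⟨-, h_idem, h_comm⟩ := hT e heT _ (h s) _ (h t)
  simp only [mul_assoc, he, hl] at h_idem h_comm ⊢
  exact ⟨h_idem.symm, h_comm⟩

/-- If `eSe` is idempotent and commutative, then `SeS` is 2-testable. -/
theorem twoTestable_of_local_semilattice {S : Type*} [Semigroup S] {e : S} (he : e * e = e)
    (h : ∀ s t : S, (e * s * e) * (e * s * e) = e * s * e ∧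
      (e * s * e) * (e * t * e) = (e * t * e) * (e * s * e)) :
    TwoTestable {x : S | ∃ s t : S, x = s * e * t} := by
  rintro _ ⟨s, t, rfl⟩ _ ⟨u, v, rfl⟩ _ ⟨w, r, rfl⟩
  have hl (a : S) : e * (e * a) = e * a := by rw [← mul_assoc, he]
  have h_sq := (h (t * s) s).1
  have h_idem := (h (t * u * e * v * s) s).1
  have h_comm := (h (t * u * e * v * s) (t * w * e * r * s)).2
  refine ⟨?_, ?_, ?_⟩
  · simpa only [mul_assoc, hl] using congrArg (fun a => s * a * t) h_sq.symm
  · simpa only [mul_assoc, hl] using congrArg (fun a => s * a * t) h_idem.symm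
  · simpa only [mul_assoc, hl] using congrArg (fun a => s * a * t) h_comm

/-- For a finite semigroup `S` the following are equivalent:
(a) `eSe` is commutative and idempotent for every idempotent `e ∈ S`;
(b) `Se` is 2-testable for every idempotent `e ∈ S`;
(c) `eS` is 2-testable for every idempotent `e ∈ S`;
(d) `SeS` is 2-testable for every idempotent `e ∈ S`. -/
theorem local_testability_semigroup_tfae {S : Type*} [Semigroup S] [Finite S] :
    List.TFAE
      [ (∀ e : S, e * e = e → ∀ s t : S,
          (e * s * e) * (e * s * e) = e * s * e ∧
          (e * s * e) * (e * t * e) = (e * t * e) * (e * s * e)),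
        (∀ e : S, e * e = e → TwoTestable {x : S | ∃ s : S, x = s * e}),
        (∀ e : S, e * e = e → TwoTestable {x : S | ∃ s : S, x = e * s}),
        (∀ e : S, e * e = e → TwoTestable {x : S | ∃ s t : S, x = s * e * t}) ] := by
  tfae_have 1 → 4 := fun h e he => twoTestable_of_local_semilattice he (h e he)
  tfae_have 4 → 2 := fun h e he => (h e he).mono <| by
    rintro _ ⟨s, rfl⟩
    exact ⟨s, e, by rw [mul_assoc, he]⟩
  tfae_have 4 → 3 := fun h e he => (h e he).mono <| by
    rintro _ ⟨s, rfl⟩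
    exact ⟨e, s, by rw [he]⟩
  tfae_have 2 → 1 := fun h e he => (h e he).local_semilattice he fun s => ⟨e * s, rfl⟩
  tfae_have 3 → 1 := fun h e he =>
    (h e he).local_semilattice he fun s => ⟨s * e, mul_assoc e s e⟩
  tfae_finish
end

section
/- Let S be a semigroup such that for every idempotent e ∈ S the subsemigroup Se satisfies the identities of 2-testability. Then for every idempotent e ∈ S the subsemigroup eSe is commutative and idempotent, i.e., for all s, t ∈ S: (ese)² = ese and (ese)(ete) = (ete)(ese). -/
/-- If `Se` satisfies the identities of 2-testability for every idempotent
`e ∈ S`, then `eSe` is commutative and idempotent for every idempotent `e ∈ S`. -/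
theorem eSe_comm_idem_of_Se_two_testable {S : Type*} [Semigroup S]
    (h : ∀ e : S, e * e = e → TwoTestable {x : S | ∃ s : S, x = s * e}) :
    ∀ e : S, e * e = e → ∀ s t : S,
      (e * s * e) * (e * s * e) = e * s * e ∧
      (e * s * e) * (e * t * e) = (e * t * e) * (e * s * e) := by
  intro e he s t
  obtain ⟨-, hidem, hcomm⟩ :=
    h e he e ⟨e, he.symm⟩ (s * e) ⟨s, rfl⟩ (t * e) ⟨t, rfl⟩
  have absorb : ∀ x : S, e * (e * x) = e * x := fun x => by rw [← mul_assoc, he]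
  simp only [mul_assoc, he, absorb] at hidem hcomm ⊢
  exact ⟨hidem.symm, hcomm⟩
end

section
/- Let S be a semigroup such that for every idempotent e ∈ S the subsemigroup eSe is commutative and idempotent. Then for every idempotent e ∈ S the subsemigroup SeS satisfies the identities of 2-testability: for all u, v, w ∈ SeS, u² = u³, uvu = uvuvu, and uvuwu = uwuvu. -/
/-- If `eSe` is commutative and idempotent for every idempotent `e ∈ S`, then
`SeS` satisfies the identities of 2-testability for every idempotent `e ∈ S`. -/
theorem SeS_two_testable_of_eSe_comm_idem {S : Type*} [Semigroup S]
    (h : ∀ e : S, e * e = e → ∀ s t : S,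
      (e * s * e) * (e * s * e) = e * s * e ∧
      (e * s * e) * (e * t * e) = (e * t * e) * (e * s * e)) :
    ∀ e : S, e * e = e → TwoTestable {x : S | ∃ s t : S, x = s * e * t} := by
  rintro e he _ ⟨s, t, rfl⟩ _ ⟨p, q, rfl⟩ _ ⟨u, v, rfl⟩
  have he' (a : S) : e * (e * a) = e * a := by rw [← mul_assoc, he]
  have idem (a : S) : (e * a * e) * (e * a * e) = e * a * e := (h e he a a).1
  have comm (a b : S) : (e * a * e) * (e * b * e) = (e * b * e) * (e * a * e) := (h e he a b).2
  have prod (a b c d : S) :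
      s * ((e * (t * a) * e) * (e * (b * s) * e) * ((e * (t * c) * e) * (e * (d * s) * e))) * t =
        s * e * t * (a * e * b) * (s * e * t) * (c * e * d) * (s * e * t) := by
    simp only [mul_assoc, he']
  have hbc (a b : S) : (e * (t * a) * e) * (e * (b * s) * e) = e * (t * a * e * b * s) * e := by
    simp only [mul_assoc, he']
  refine ⟨?_, ?_, ?_⟩
  · have := congrArg (s * · * t) (idem (t * s))
    simp only [mul_assoc, he'] at this ⊢
    exact this.symm
  · rw [← prod, hbc, idem]
    simp only [mul_assoc]
  · rw [← prod, ← prod, hbc, hbc, comm]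
end

section
/- A language L of nonempty words over a finite alphabet Σ is locally threshold testable if and only if its syntactic semigroup S(L) is finite and aperiodic and, for any two idempotents e, f ∈ S(L) and any elements a, u, b ∈ S(L), one has eafuebf = ebfueaf. -/
/-- `spow s n = s^(n+1)`: the `(n+1)`-st power of an element of a semigroup. -/
def spow {S : Type*} [Semigroup S] (s : S) : ℕ → S
  | 0 => s
  | n + 1 => spow s n * s

/-- Number of occurrences of the word `f` in the word `w`: the number of
positions `i` such that the factor of `w` of length `|f|` starting at `i`
equals `f`. -/
def occCount {A : Type*} [DecidableEq A] (f w : List A) : ℕ :=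
  ((List.range (w.length + 1 - f.length)).filter
    fun i => (w.drop i).take f.length = f).length

/-- `L` is `l`-threshold `k`-testable: membership of a nonempty word is determined
by its prefix and suffix of length `k-1` and, for each threshold `j ≤ l`, the set
of factors of length `k` occurring at least `j` times. -/
def LThresholdKTestable {A : Type*} [DecidableEq A]
    (L : Set (List A)) (l k : ℕ) : Prop :=
  ∀ u v : List A, u ≠ [] → v ≠ [] →
    u.take (k - 1) = v.take (k - 1) →
    u.drop (u.length - (k - 1)) = v.drop (v.length - (k - 1)) →
    (∀ j ≤ l, ∀ f : List A, f.length = k → (j ≤ occCount f u ↔ j ≤ occCount f v)) →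
    (u ∈ L ↔ v ∈ L)

/-- `L` is locally threshold testable: it is `l`-threshold `k`-testable for
some `k ≥ 1` and `l ≥ 1`. -/
def LocallyThresholdTestable {A : Type*} [DecidableEq A] (L : Set (List A)) : Prop :=
  ∃ k ≥ 1, ∃ l ≥ 1, LThresholdKTestable L l k

/-- The syntactic congruence of `L` on the free semigroup of nonempty words. -/
def synSetoid {A : Type*} (L : Set (List A)) : Setoid {w : List A // w ≠ []} where
  r u v := ∀ x y : List A, (x ++ u.1 ++ y ∈ L ↔ x ++ v.1 ++ y ∈ L)
  iseqv := ⟨fun _ _ _ => Iff.rfl, fun h x y => (h x y).symm,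
    fun h1 h2 x y => (h1 x y).trans (h2 x y)⟩

/-- The syntactic semigroup of `L`. -/
def SynSemigroup {A : Type*} (L : Set (List A)) : Type _ :=
  Quotient (synSetoid L)

instance {A : Type*} (L : Set (List A)) : Semigroup (SynSemigroup L) where
  mul := Quotient.map₂ (fun u v => ⟨u.1 ++ v.1, by simp [u.2]⟩)
    (by
      intro u u' hu v v' hv x y
      have h1 := hu x (v.1 ++ y)
      have h2 := hv (x ++ u'.1) y
      simp only [List.append_assoc] at h1 h2 ⊢
      exact h1.trans h2)
  mul_assoc a b c := by
    induction a using Quotient.ind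
    induction b using Quotient.ind
    induction c using Quotient.ind
    apply Quotient.sound
    intro x y
    simp [List.append_assoc]

section Occurrences

variable {A : Type*} [DecidableEq A]

theorem occCount_of_length_lt {f w : List A} (h : w.length < f.length) : occCount f w = 0 := by
  simp [occCount, Nat.sub_eq_zero_of_le h]

theorem occCount_cons {f : List A} (hf : f ≠ []) (b : A) (w : List A) :
    occCount f (b :: w) = (if (b :: w).take f.length = f then 1 else 0) + occCount f w := by
  have hpos := List.length_pos_iff.2 hf
  rcases lt_or_ge (b :: w).length f.length with h | h
  · have h' : (b :: w).take f.length ≠ f := fun he => by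
      have := congrArg List.length he
      rw [List.length_take] at this
      omega
    rw [occCount_of_length_lt h, if_neg h', occCount_of_length_lt (by simp at h; omega)]
  · have hlen : (b :: w).length + 1 - f.length = (w.length + 1 - f.length) + 1 := by
      simp at h ⊢; omega
    rw [occCount, occCount, hlen, List.range_succ_eq_map, List.filter_cons]
    simp only [List.drop_zero, List.filter_map, Function.comp_def, List.drop_succ_cons]
    by_cases hbw : (b :: w).take f.length = f
    · simp [hbw, add_comm]
    · simp [hbw]

theorem occCount_append_append {f : List A} (hf : f ≠ []) {m : List A}
    (hm : f.length ≤ m.length + 1) (w₁ w₂ : List A) :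
    occCount f (w₁ ++ m ++ w₂) + occCount f m = occCount f (w₁ ++ m) + occCount f (m ++ w₂) := by
  induction w₁ with
  | nil => simp [add_comm]
  | cons b w ih =>
    simp only [List.cons_append]
    rw [occCount_cons hf, occCount_cons hf]
    have : (b :: (w ++ m ++ w₂)).take f.length = (b :: (w ++ m)).take f.length := by
      rw [← List.cons_append, List.take_append_of_le_length (by simp; omega)]
    rw [this]
    omega

theorem occCount_le_append_left {f : List A} (hf : f ≠ []) (w v : List A) :
    occCount f v ≤ occCount f (w ++ v) := by
  induction w with
  | nil => simp
  | cons b w ih =>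
    rw [List.cons_append, occCount_cons hf]
    omega

theorem occCount_le_append_right {f : List A} (hf : f ≠ []) (w v : List A) :
    occCount f w ≤ occCount f (w ++ v) := by
  induction w with
  | nil => simp [occCount_of_length_lt (w := []) (List.length_pos_iff.2 hf)]
  | cons b w ih =>
    rw [List.cons_append, occCount_cons hf, occCount_cons hf]
    by_cases h : (b :: w).take f.length = f
    · have hlen : f.length ≤ (b :: w).length := by
        have := congrArg List.length h
        rw [List.length_take] at this
        omega
      have h' : (b :: (w ++ v)).take f.length = f := by
        rw [← List.cons_append, List.take_append_of_le_length hlen, h]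
      rw [if_pos h, if_pos h']
      omega
    · rw [if_neg h]
      omega

end Occurrences

section Testable

theorem List.drop_length_sub_append {α : Type*} {n : ℕ} {v : List α} (h : n ≤ v.length)
    (w : List α) : (w ++ v).drop ((w ++ v).length - n) = v.drop (v.length - n) := by
  rw [List.drop_append, List.drop_of_length_le (l := w) (by simp; omega), List.nil_append]
  congr 1
  simp; omega

variable {A : Type*} [DecidableEq A]

/-- Two words have the same prefix and suffix of length `k - 1` and the same factors of length `k`
counted up to threshold `l`. -/
structure ThresholdEquiv (l k : ℕ) (u v : List A) : Prop where
  take_eq : u.take (k - 1) = v.take (k - 1)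
  drop_eq : u.drop (u.length - (k - 1)) = v.drop (v.length - (k - 1))
  occ_iff : ∀ j ≤ l, ∀ f : List A, f.length = k → (j ≤ occCount f u ↔ j ≤ occCount f v)

theorem ThresholdEquiv.eq_or_le {l k : ℕ} {u v : List A} (h : ThresholdEquiv l k u v) :
    u = v ∨ (k - 1 ≤ u.length ∧ k - 1 ≤ v.length) := by
  have h1 := congrArg List.length h.take_eq
  simp only [List.length_take] at h1
  by_cases hu : k - 1 ≤ u.length
  · exact Or.inr ⟨hu, by omega⟩
  · left
    have := h.take_eq
    rwa [List.take_of_length_le (by omega), List.take_of_length_le (by omega)] at this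

theorem ThresholdEquiv.append {l k : ℕ} (hk : 1 ≤ k) {u v : List A} (h : ThresholdEquiv l k u v)
    (x y : List A) : ThresholdEquiv l k (x ++ u ++ y) (x ++ v ++ y) := by
  rcases h.eq_or_le with rfl | ⟨hu, hv⟩
  · exact ⟨rfl, rfl, fun _ _ _ _ => Iff.rfl⟩
  obtain ⟨p, hp⟩ : ∃ p, p = u.take (k - 1) := ⟨_, rfl⟩
  obtain ⟨s, hs⟩ : ∃ s, s = u.drop (u.length - (k - 1)) := ⟨_, rfl⟩
  have hplen : p.length = k - 1 := by simp [hp, hu]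
  have hslen : s.length = k - 1 := by simp [hs]; omega
  obtain ⟨u₁, hu₁⟩ : ∃ u₁, u = p ++ u₁ := ⟨_, hp ▸ (List.take_append_drop _ u).symm⟩
  obtain ⟨u₂, hu₂⟩ : ∃ u₂, u = u₂ ++ s := ⟨_, hs ▸ (List.take_append_drop _ u).symm⟩
  obtain ⟨v₁, hv₁⟩ : ∃ v₁, v = p ++ v₁ :=
    ⟨_, (hp.trans h.take_eq) ▸ (List.take_append_drop _ v).symm⟩
  obtain ⟨v₂, hv₂⟩ : ∃ v₂, v = v₂ ++ s :=
    ⟨_, (hs.trans h.drop_eq) ▸ (List.take_append_drop _ v).symm⟩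
  refine ⟨?_, ?_, fun j hj f hf => ?_⟩
  · have aux : ∀ w : List A, (x ++ (p ++ w) ++ y).take (k - 1) = (x ++ p).take (k - 1) := fun w => by
      rw [show x ++ (p ++ w) ++ y = (x ++ p) ++ (w ++ y) by simp,
        List.take_append_of_le_length (by simp; omega)]
    rw [hu₁, hv₁, aux, aux]
  · rw [hu₂, hv₂]
    have aux : ∀ w : List A, (x ++ (w ++ s) ++ y).drop ((x ++ (w ++ s) ++ y).length - (k - 1)) =
        (s ++ y).drop ((s ++ y).length - (k - 1)) := fun w => by
      rw [show x ++ (w ++ s) ++ y = (x ++ w) ++ (s ++ y) by simp,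
        List.drop_length_sub_append (by simp; omega)]
    rw [aux, aux]
  · have hf0 : f ≠ [] := List.length_pos_iff.1 (by omega)
    have aux : ∀ w w₁ w₂ : List A, w = p ++ w₁ → w = w₂ ++ s →
        occCount f (x ++ w ++ y) + occCount f p + occCount f s =
          occCount f w + occCount f (x ++ p) + occCount f (s ++ y) := by
      intro w w₁ w₂ h₁ h₂
      have e₁ := occCount_append_append hf0 (m := p) (by omega) x (w₁ ++ y)
      have e₂ := occCount_append_append hf0 (m := s) (by omega) w₂ y
      rw [← h₂] at e₂
      rw [← List.append_assoc p, ← h₁, List.append_assoc x, ← List.append_assoc p, ← h₁,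
        ← List.append_assoc x] at e₁
      omega
    have e₁ := aux u u₁ u₂ hu₁ hu₂
    have e₂ := aux v v₁ v₂ hv₁ hv₂
    rcases le_or_gt l (occCount f u) with hl | hl
    · have := (h.occ_iff l le_rfl f hf).1 hl
      have := occCount_le_append_left hf0 x p
      have := occCount_le_append_right hf0 s y
      exact iff_of_true (by omega) (by omega)
    · have := h.occ_iff (occCount f u + 1) hl f hf
      have := h.occ_iff (occCount f u) hl.le f hf
      have : occCount f (x ++ u ++ y) = occCount f (x ++ v ++ y) := by omega
      rw [this]

/-- Words are classified up to `ThresholdEquiv l k` by finitely many values. -/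
theorem exists_finite_threshold_invariant.{u} {A : Type u} [DecidableEq A] [Finite A] (l k : ℕ) :
    ∃ (T : Type u) (_ : Finite T) (inv : List A → T),
      ∀ u v, inv u = inv v → ThresholdEquiv l k u v := by
  have hfin : Finite {w : List A // w.length ≤ k - 1} :=
    (List.finite_length_le A (k - 1)).to_subtype
  have hfin' : Finite {w : List A // w.length = k} :=
    (List.finite_length_eq A k).to_subtype
  refine ⟨{w : List A // w.length ≤ k - 1} × {w : List A // w.length ≤ k - 1} ×
    ({w : List A // w.length = k} → Fin (l + 1)), inferInstance,
    fun u => ⟨⟨u.take (k - 1), by simp⟩,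
      ⟨u.drop (u.length - (k - 1)), by simp; omega⟩,
      fun f => ⟨min l (occCount f.1 u), by omega⟩⟩, fun u v h => ?_⟩
  simp only [Prod.mk.injEq, Subtype.mk.injEq] at h
  obtain ⟨h₁, h₂, h₃⟩ := h
  refine ⟨h₁, h₂, fun j hj f hf => ?_⟩
  have := congrArg Fin.val (congrFun h₃ ⟨f, hf⟩)
  simp only at this
  omega

theorem LThresholdKTestable.mem_iff {L : Set (List A)} {l k : ℕ} (h : LThresholdKTestable L l k)
    {u v : List A} (hu : u ≠ []) (hv : v ≠ []) (huv : ThresholdEquiv l k u v) :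
    u ∈ L ↔ v ∈ L :=
  h u v hu hv huv.take_eq huv.drop_eq huv.occ_iff

/-- The class of a nonempty word in the syntactic semigroup. -/
def synClass {A : Type*} (L : Set (List A)) (w : List A) (hw : w ≠ []) : SynSemigroup L :=
  Quotient.mk (synSetoid L) ⟨w, hw⟩

theorem exists_synClass_eq {A : Type*} {L : Set (List A)} (s : SynSemigroup L) :
    ∃ w hw, s = synClass L w hw := by
  induction s using Quotient.ind with
  | _ w => exact ⟨w.1, w.2, rfl⟩

theorem synClass_mul {A : Type*} {L : Set (List A)} {u v : List A} (hu : u ≠ []) (hv : v ≠ []) :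
    synClass L u hu * synClass L v hv = synClass L (u ++ v) (by simp [hu]) := rfl

theorem LThresholdKTestable.synClass_eq {L : Set (List A)} {l k : ℕ} (hk : 1 ≤ k)
    (h : LThresholdKTestable L l k) {u v : List A} (hu : u ≠ []) (hv : v ≠ [])
    (huv : ThresholdEquiv l k u v) : synClass L u hu = synClass L v hv :=
  Quotient.sound fun x y => h.mem_iff (by simp [hu]) (by simp [hv]) (huv.append hk x y)

theorem LThresholdKTestable.finite_synSemigroup [Finite A] {L : Set (List A)} {l k : ℕ}
    (hk : 1 ≤ k) (h : LThresholdKTestable L l k) : Finite (SynSemigroup L) := by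
  obtain ⟨T, _, inv, hinv⟩ := exists_finite_threshold_invariant (A := A) l k
  choose w hw hws using exists_synClass_eq (L := L)
  refine Finite.of_injective (fun s => inv (w s)) fun s t hst => ?_
  rw [hws s, hws t]
  exact h.synClass_eq hk _ _ (hinv _ _ hst)

theorem exists_spow_synClass {A : Type*} {L : Set (List A)} (w : List A) (hw : w ≠ []) (n : ℕ) :
    ∃ hn, spow (synClass L w hw) n = synClass L (List.replicate (n + 1) w).flatten hn := by
  induction n with
  | zero => exact ⟨by simpa using hw, by simp [spow]⟩
  | succ n ih =>
    obtain ⟨hn, h⟩ := ih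
    refine ⟨by simp [hw], ?_⟩
    rw [spow, h, synClass_mul]
    congr 1
    simp [List.replicate_succ' (n := n + 1)]

theorem LThresholdKTestable.aperiodic [Finite A] {L : Set (List A)} {l k : ℕ}
    (hk : 1 ≤ k) (h : LThresholdKTestable L l k) (s : SynSemigroup L) :
    ∃ n, spow s n = spow s n * s := by
  obtain ⟨w, hw, rfl⟩ := exists_synClass_eq s
  obtain ⟨T, _, inv, hinv⟩ := exists_finite_threshold_invariant (A := A) l k
  let p : ℕ → List A := fun n => (List.replicate (n + k + 1) w).flatten
  have hp₁ : ∀ n, p (n + 1) = w ++ p n := fun n => by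
    simp only [p]
    rw [show n + 1 + k + 1 = (n + k + 1) + 1 by omega, List.replicate_succ, List.flatten_cons]
  have hp₂ : ∀ n, p (n + 1) = p n ++ w := fun n => by
    simp only [p]
    rw [show n + 1 + k + 1 = (n + k + 1) + 1 by omega, List.replicate_succ', List.flatten_append]
    simp
  have hlen : ∀ n, k - 1 ≤ (p n).length := fun n => by
    have := List.length_pos_iff.2 hw
    simp only [p, List.length_flatten, List.map_replicate, List.sum_replicate, smul_eq_mul]
    nlinarith [Nat.sub_le k 1]
  obtain ⟨i, j, hij, hinvij⟩ : ∃ i j, i < j ∧ inv (p i) = inv (p j) := by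
    obtain ⟨i, j, hij, he⟩ := Finite.exists_ne_map_eq_of_infinite (fun n => inv (p n))
    rcases hij.lt_or_gt with hlt | hlt
    · exact ⟨i, j, hlt, he⟩
    · exact ⟨j, i, hlt, he.symm⟩
  have hij' := hinv _ _ hinvij
  have hequiv : ThresholdEquiv l k (p i) (p (i + 1)) := by
    refine ⟨?_, ?_, fun m hm f hf => ?_⟩
    · rw [hp₂, List.take_append_of_le_length (hlen i)]
    · rw [hp₁, List.drop_length_sub_append (hlen i)]
    · have hf0 : f ≠ [] := List.length_pos_iff.1 (by omega)
      have hmono : Monotone fun n => occCount f (p n) := monotone_nat_of_le_succ fun n => by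
        simp only [hp₁]
        exact occCount_le_append_left hf0 w (p n)
      have h₁ : occCount f (p i) ≤ occCount f (p (i + 1)) := hmono (Nat.le_succ i)
      have h₂ : occCount f (p (i + 1)) ≤ occCount f (p j) := hmono hij
      have := hij'.occ_iff m hm f hf
      omega
  obtain ⟨h₁, e₁⟩ := exists_spow_synClass (L := L) w hw (i + k)
  obtain ⟨h₂, e₂⟩ := exists_spow_synClass (L := L) w hw (i + 1 + k)
  refine ⟨i + k, ?_⟩
  have : spow (synClass L w hw) (i + k) * synClass L w hw =
      spow (synClass L w hw) (i + 1 + k) := by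
    rw [show i + 1 + k = (i + k) + 1 by omega]
    rfl
  rw [this, e₁, e₂]
  exact h.synClass_eq hk h₁ h₂ hequiv

theorem exists_long_synClass {A : Type*} {L : Set (List A)} {e : SynSemigroup L}
    (he : e * e = e) (n : ℕ) :
    ∃ w hw, e = synClass L w hw ∧ n ≤ w.length := by
  induction n with
  | zero =>
    obtain ⟨w, hw, h⟩ := exists_synClass_eq e
    exact ⟨w, hw, h, Nat.zero_le _⟩
  | succ n ih =>
    obtain ⟨w, hw, rfl, hn⟩ := ih
    have := List.length_pos_iff.2 hw
    exact ⟨w ++ w, by simp [hw], by rw [← synClass_mul hw hw, he], by simp; omega⟩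

theorem LThresholdKTestable.swap {L : Set (List A)} {l k : ℕ} (hk : 1 ≤ k)
    (h : LThresholdKTestable L l k) {e f : SynSemigroup L} (he : e * e = e) (hf : f * f = f)
    (a u b : SynSemigroup L) :
    e * a * f * u * e * b * f = e * b * f * u * e * a * f := by
  obtain ⟨x, hx, rfl, hxk⟩ := exists_long_synClass he k
  obtain ⟨y, hy, rfl, hyk⟩ := exists_long_synClass hf k
  obtain ⟨a, ha, rfl⟩ := exists_synClass_eq a
  obtain ⟨u, hu, rfl⟩ := exists_synClass_eq u
  obtain ⟨b, hb, rfl⟩ := exists_synClass_eq b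
  simp only [synClass_mul]
  have hocc : ∀ (g : List A), g.length = k → ∀ a b : List A,
      occCount g (x ++ a ++ y ++ u ++ x ++ b ++ y) + occCount g y + occCount g x =
        occCount g (x ++ a ++ y) + occCount g (y ++ u ++ x) + occCount g (x ++ b ++ y) := by
    intro g hg a b
    have hg0 : g ≠ [] := List.length_pos_iff.1 (by omega)
    have h₁ := occCount_append_append hg0 (m := y) (by omega) (x ++ a) (u ++ x ++ b ++ y)
    have h₂ := occCount_append_append hg0 (m := x) (by omega) (y ++ u) (b ++ y)
    simp only [List.append_assoc] at h₁ h₂ ⊢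
    omega
  refine h.synClass_eq hk _ _ ⟨?_, ?_, fun j _ g hg => ?_⟩
  · simp only [List.append_assoc]
    rw [List.take_append_of_le_length (by omega), List.take_append_of_le_length (by omega)]
  · rw [List.drop_length_sub_append (by omega), List.drop_length_sub_append (by omega)]
  · have h₁ := hocc g hg a b
    have h₂ := hocc g hg b a
    omega

end Testable

section Walks

variable {V E M : Type*} [Monoid M]

/-- `IsWalk src tgt x l y`: the list of edges `l` is a walk from `x` to `y`. -/
def IsWalk (src tgt : E → V) : V → List E → V → Prop
  | x, [], y => x = y
  | x, e :: l, y => src e = x ∧ IsWalk src tgt (tgt e) l y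

/-- The product of the labels of a list of edges. -/
def walkLabel (lab : E → M) (l : List E) : M := (l.map lab).prod

@[simp] theorem walkLabel_nil (lab : E → M) : walkLabel lab [] = 1 := rfl

@[simp] theorem walkLabel_cons (lab : E → M) (e : E) (l : List E) :
    walkLabel lab (e :: l) = lab e * walkLabel lab l := by
  simp [walkLabel]

@[simp] theorem walkLabel_append (lab : E → M) (l₁ l₂ : List E) :
    walkLabel lab (l₁ ++ l₂) = walkLabel lab l₁ * walkLabel lab l₂ := by
  simp [walkLabel]

/-- The labels of walks satisfy `p q r = r q p` for `p, r : x → y` and `q : y → x`. -/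
def SwapLaw (src tgt : E → V) (lab : E → M) : Prop :=
  ∀ x y p q r, IsWalk src tgt x p y → IsWalk src tgt y q x → IsWalk src tgt x r y →
    walkLabel lab (p ++ q ++ r) = walkLabel lab (r ++ q ++ p)

variable {src tgt : E → V} {lab : E → M}

@[simp] theorem isWalk_nil {x y : V} : IsWalk src tgt x [] y ↔ x = y := Iff.rfl

@[simp] theorem isWalk_cons {x y : V} {e : E} {l : List E} :
    IsWalk src tgt x (e :: l) y ↔ src e = x ∧ IsWalk src tgt (tgt e) l y := Iff.rfl

theorem isWalk_append {x y : V} {l₁ l₂ : List E} :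
    IsWalk src tgt x (l₁ ++ l₂) y ↔
      ∃ z, IsWalk src tgt x l₁ z ∧ IsWalk src tgt z l₂ y := by
  induction l₁ generalizing x with
  | nil => simp
  | cons e l ih => simp [ih, and_assoc]

theorem IsWalk.append {x y z : V} {l₁ l₂ : List E} (h₁ : IsWalk src tgt x l₁ z)
    (h₂ : IsWalk src tgt z l₂ y) : IsWalk src tgt x (l₁ ++ l₂) y :=
  isWalk_append.2 ⟨z, h₁, h₂⟩

theorem IsWalk.end_unique {x y z : V} {l : List E} (h₁ : IsWalk src tgt x l y)
    (h₂ : IsWalk src tgt x l z) : y = z := by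
  induction l generalizing x with
  | nil => simp_all
  | cons e l ih => exact ih h₁.2 h₂.2

theorem IsWalk.of_append_left {x y z : V} {l₁ l₂ : List E}
    (h : IsWalk src tgt x (l₁ ++ l₂) y) (h₁ : IsWalk src tgt x l₁ z) :
    IsWalk src tgt z l₂ y := by
  obtain ⟨z', hz, hz'⟩ := isWalk_append.1 h
  exact (h₁.end_unique hz) ▸ hz'

theorem IsWalk.split_at_edge {x y : V} {l₁ l₂ : List E} {e : E}
    (h : IsWalk src tgt x (l₁ ++ e :: l₂) y) :
    IsWalk src tgt x l₁ (src e) ∧ IsWalk src tgt (tgt e) l₂ y := by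
  obtain ⟨z, hz, rfl, h'⟩ := isWalk_append.1 h
  exact ⟨hz, h'⟩

theorem IsWalk.exists_split_src {x y : V} {l : List E} {e : E}
    (h : IsWalk src tgt x l y) (he : e ∈ l) :
    ∃ l₁ l₂, l = l₁ ++ l₂ ∧ IsWalk src tgt x l₁ (src e) ∧ IsWalk src tgt (src e) l₂ y := by
  obtain ⟨l₁, l₂, rfl⟩ := List.append_of_mem he
  obtain ⟨h₁, h₂⟩ := h.split_at_edge
  exact ⟨l₁, e :: l₂, rfl, h₁, rfl, h₂⟩

/-- A walk passes through every vertex reachable from its start along its own edges. -/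
theorem IsWalk.exists_split_of_subset {x y z : V} {l m : List E}
    (h : IsWalk src tgt x l y) (hm : IsWalk src tgt x m z) (hml : ∀ e ∈ m, e ∈ l) :
    ∃ l₁ l₂, l = l₁ ++ l₂ ∧ IsWalk src tgt x l₁ z ∧ IsWalk src tgt z l₂ y := by
  rcases List.eq_nil_or_concat m with rfl | ⟨m', e, rfl⟩
  · obtain rfl := isWalk_nil.1 hm
    exact ⟨[], l, rfl, rfl, h⟩
  · simp only [List.concat_eq_append] at hm hml
    obtain ⟨-, hz⟩ := hm.split_at_edge
    obtain rfl := isWalk_nil.1 hz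
    obtain ⟨l₁, l₂, rfl⟩ := List.append_of_mem (hml e (by simp))
    obtain ⟨h₁, h₂⟩ := h.split_at_edge
    exact ⟨l₁ ++ [e], l₂, by simp, h₁.append ⟨rfl, rfl⟩, h₂⟩

theorem List.exists_first_mem {α : Type*} (P : α → Prop) {l : List α} (h : ∃ a ∈ l, P a) :
    ∃ l₁ a l₂, l = l₁ ++ a :: l₂ ∧ P a ∧ ∀ b ∈ l₁, ¬ P b := by
  induction l with
  | nil => simp at h
  | cons b l ih =>
    by_cases hb : P b
    · exact ⟨[], b, l, rfl, hb, by simp⟩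
    · obtain ⟨l₁, a, l₂, rfl, ha, hl⟩ := ih (by simpa [hb] using h)
      exact ⟨b :: l₁, a, l₂, rfl, ha, by simpa [hb] using hl⟩

theorem SwapLaw.exists_cons (hs : SwapLaw src tgt lab) {x y : V} {a : E} {u v : List E}
    (hu : IsWalk src tgt x (a :: u) y) (hv : IsWalk src tgt x v y) (huv : (a :: u).Perm v) :
    ∃ w, IsWalk src tgt x (a :: w) y ∧ (a :: w).Perm v ∧
      walkLabel lab (a :: w) = walkLabel lab v := by
  obtain ⟨p, v₂, rfl⟩ := List.append_of_mem (huv.subset (List.mem_cons_self (a := a)))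
  obtain ⟨rfl, hu'⟩ := hu
  obtain ⟨hp, hv₂⟩ := hv.split_at_edge
  have huv' : u.Perm (p ++ v₂) :=
    (List.perm_cons a).1 (huv.trans List.perm_middle)
  rcases p.eq_nil_or_concat with rfl | ⟨p', g', hp'⟩
  · exact ⟨v₂, hv, .refl _, rfl⟩
  obtain ⟨u₁, g, u₂, rfl, hg, hu₁⟩ := List.exists_first_mem (· ∈ p) (l := u)
    ⟨g', huv'.symm.subset (by simp [hp']), by simp [hp']⟩
  obtain ⟨p₁, p₂, rfl, hp₁, hp₂⟩ := hp.exists_split_src hg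
  obtain ⟨v₃, v₄, rfl, hv₃, hv₄⟩ := hv₂.exists_split_of_subset hu'.split_at_edge.1
    (fun e he => by
      have h1 := huv'.subset (List.mem_append_left _ he)
      exact (List.mem_append.1 h1).resolve_left (hu₁ e he))
  refine ⟨v₃ ++ p₂ ++ p₁ ++ v₄, ⟨rfl, ((hv₃.append hp₂).append hp₁).append hv₄⟩, ?_, ?_⟩
  · classical
    rw [List.perm_iff_count]
    intro b
    simp only [List.count_cons, List.count_append]
    omega
  · have := hs _ _ p₁ p₂ (a :: v₃) hp₁ hp₂ ⟨rfl, hv₃⟩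
    simp only [walkLabel_append, walkLabel_cons, mul_assoc] at this ⊢
    simp only [← mul_assoc] at this ⊢
    rw [this]

/-- Coterminal walks using the same edges with the same multiplicities have the same label. -/
theorem SwapLaw.label_eq_of_perm (hs : SwapLaw src tgt lab) {x y : V} {u v : List E}
    (hu : IsWalk src tgt x u y) (hv : IsWalk src tgt x v y) (huv : u.Perm v) :
    walkLabel lab u = walkLabel lab v := by
  induction u generalizing x v with
  | nil => rw [huv.nil_eq]
  | cons a u ih =>
    obtain ⟨w, hw, hwv, hlab⟩ := hs.exists_cons hu hv huv
    rw [← hlab, walkLabel_cons, walkLabel_cons,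
      ih hu.2 hw.2 ((List.perm_cons a).1 (huv.trans hwv.symm))]

theorem SwapLaw.commute (hs : SwapLaw src tgt lab) {x : V} {p q : List E}
    (hp : IsWalk src tgt x p x) (hq : IsWalk src tgt x q x) :
    Commute (walkLabel lab p) (walkLabel lab q) := by
  show _ = _
  simpa using hs x x p [] q hp rfl hq

/-- The label obtained by inserting a central element at a vertex does not depend on the visit. -/
theorem insert_eq_of_commute {x z : V} {u₁ u₂ w₁ w₂ : List E} {t : M}
    (h : u₁ ++ u₂ = w₁ ++ w₂) (hu : IsWalk src tgt x u₁ z) (hw : IsWalk src tgt x w₁ z)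
    (ht : ∀ m, IsWalk src tgt z m z → Commute t (walkLabel lab m)) :
    walkLabel lab u₁ * t * walkLabel lab u₂ = walkLabel lab w₁ * t * walkLabel lab w₂ := by
  rcases List.append_eq_append_iff.1 h with ⟨m, rfl, rfl⟩ | ⟨m, rfl, rfl⟩
  · have := (ht m (hw.of_append_left hu)).eq
    simp only [walkLabel_append, mul_assoc]
    rw [← mul_assoc t, this, mul_assoc]
  · have := (ht m (hu.of_append_left hw)).eq
    simp only [walkLabel_append, mul_assoc]
    rw [← mul_assoc t, this, mul_assoc]

/-- A letter occurring more than `|M|` times is preceded twice by prefixes with equal labels. -/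
theorem exists_repeated_label [Finite M] [DecidableEq E] (lab : E → M) {a : E} {u : List E}
    (h : Nat.card M < u.count a) :
    ∃ p r s, u = p ++ a :: r ++ a :: s ∧ walkLabel lab (p ++ a :: r) = walkLabel lab p := by
  classical
  by_contra! hne
  suffices ∃ T : Finset M, T.card = u.count a ∧
      ∀ m ∈ T, ∃ p s, u = p ++ a :: s ∧ walkLabel lab p = m by
    obtain ⟨T, hT, -⟩ := this
    have := Fintype.ofFinite M
    have := T.card_le_univ
    rw [Nat.card_eq_fintype_card] at h
    omega
  clear h
  induction u using List.reverseRecOn with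
  | nil => exact ⟨∅, by simp⟩
  | append_singleton u b ih =>
    obtain ⟨T, hT, hT'⟩ := ih (fun p r s h => hne p r (s ++ [b]) (by simp [h]))
    by_cases hb : b = a
    · subst hb
      refine ⟨insert (walkLabel lab u) T, ?_, ?_⟩
      · rw [Finset.card_insert_of_notMem, hT]
        · simp
        · intro hm
          obtain ⟨p, s, rfl, hp⟩ := hT' _ hm
          exact hne p s [] (by simp) hp.symm
      · intro m hm
        rcases Finset.mem_insert.1 hm with rfl | hm
        · exact ⟨u, [], rfl, rfl⟩
        · obtain ⟨p, s, rfl, hp⟩ := hT' _ hm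
          exact ⟨p, s ++ [b], by simp, hp⟩
    · refine ⟨T, by simp [hT, hb], fun m hm => ?_⟩
      obtain ⟨p, s, rfl, hp⟩ := hT' _ hm
      exact ⟨p, s ++ [b], by simp, hp⟩

theorem mul_pow_of_mul_eq {p t : M} (h : p * t = p) (k : ℕ) : p * t ^ k = p := by
  induction k with
  | zero => simp
  | succ k ih => rw [pow_succ, ← mul_assoc, ih, h]

/-- A walk `c` whose edges are all frequent in `u` extends to a closed walk whose insertion does
not change the label, even in presence of copies of the closed walk `c ++ b`. -/
theorem SwapLaw.exists_absorbed [Finite M] [DecidableEq E] (hs : SwapLaw src tgt lab)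
    {x y z z₀ : V} {u b c : List E} (hu : IsWalk src tgt x u y)
    (hc : IsWalk src tgt z c z₀) (hb : IsWalk src tgt z₀ b z)
    (hcu : ∀ e ∈ c, Nat.card M < u.count e) :
    ∃ d, IsWalk src tgt z₀ d z ∧ ∀ (k j : ℕ) (u₁ u₂ : List E), u = u₁ ++ u₂ →
      IsWalk src tgt x u₁ z →
      walkLabel lab u₁ * walkLabel lab (c ++ d) ^ k * walkLabel lab (c ++ b) ^ j *
        walkLabel lab u₂ =
      walkLabel lab u₁ * walkLabel lab (c ++ b) ^ j * walkLabel lab u₂ := by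
  induction c generalizing z b with
  | nil =>
    obtain rfl := isWalk_nil.1 hc
    exact ⟨[], rfl, by simp⟩
  | cons a c ih =>
    obtain ⟨rfl, hc⟩ := hc
    obtain ⟨d, hd, hd'⟩ := ih (b := b ++ [a]) hc (hb.append ⟨rfl, rfl⟩)
      (fun e he => hcu e (List.mem_cons_of_mem _ he))
    obtain ⟨p, r, s, hprs, hlab⟩ := exists_repeated_label lab (hcu a List.mem_cons_self)
    have hu' := hprs ▸ hu
    rw [List.append_assoc, List.cons_append] at hu'
    obtain ⟨hp, hrs⟩ := hu'.split_at_edge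
    obtain ⟨hr, hs'⟩ := hrs.split_at_edge
    have hcd : IsWalk src tgt (tgt a) (c ++ d) (tgt a) := hc.append hd
    have hra : IsWalk src tgt (tgt a) (r ++ [a]) (tgt a) := hr.append ⟨rfl, rfl⟩
    have hcb : IsWalk src tgt (src a) (a :: c ++ b) (src a) := ⟨rfl, hc.append hb⟩
    have hcdr : IsWalk src tgt (src a) (a :: c ++ (d ++ r)) (src a) :=
      ⟨rfl, hc.append (hd.append hr)⟩
    refine ⟨d ++ r, hd.append hr, fun k j u₁ u₂ hu12 hu₁ => ?_⟩
    have hsplit : u = p ++ (a :: (r ++ a :: s)) := by simp [hprs]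
    have hcomm : ∀ m, IsWalk src tgt (src a) m (src a) →
        Commute (walkLabel lab (a :: c ++ (d ++ r)) ^ k * walkLabel lab (a :: c ++ b) ^ j)
          (walkLabel lab m) := fun m hm =>
      ((hs.commute hcdr hm).pow_left k).mul_left ((hs.commute hcb hm).pow_left j)
    have hcomm' : ∀ m, IsWalk src tgt (src a) m (src a) →
        Commute (walkLabel lab (a :: c ++ b) ^ j) (walkLabel lab m) := fun m hm =>
      (hs.commute hcb hm).pow_left j
    rw [mul_assoc (walkLabel lab u₁),
      insert_eq_of_commute (hu12.symm.trans hsplit) hu₁ hp hcomm,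
      insert_eq_of_commute (hu12.symm.trans hsplit) hu₁ hp hcomm']
    have hkey := hd' k j (p ++ [a]) (r ++ a :: s) (by simp [hsplit]) (hp.append ⟨rfl, rfl⟩)
    have hP : walkLabel lab p * (lab a * walkLabel lab r) ^ k = walkLabel lab p :=
      mul_pow_of_mul_eq (by simpa using hlab) k
    have hg : SemiconjBy (lab a) (walkLabel lab (c ++ (b ++ [a])) ^ j)
        (walkLabel lab (a :: c ++ b) ^ j) :=
      SemiconjBy.pow_right (by simp [SemiconjBy, mul_assoc]) j
    have hc1 : SemiconjBy (lab a) ((walkLabel lab (c ++ d) * walkLabel lab (r ++ [a])) ^ k)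
        (walkLabel lab (a :: c ++ (d ++ r)) ^ k) :=
      SemiconjBy.pow_right (by simp [SemiconjBy, mul_assoc]) k
    have hr1 : SemiconjBy (lab a) (walkLabel lab (r ++ [a]) ^ k)
        ((lab a * walkLabel lab r) ^ k) :=
      SemiconjBy.pow_right (by simp [SemiconjBy, mul_assoc]) k
    have hct : (walkLabel lab (c ++ d) * walkLabel lab (r ++ [a])) ^ k =
        walkLabel lab (r ++ [a]) ^ k * walkLabel lab (c ++ d) ^ k := by
      rw [(hs.commute hcd hra).eq, (hs.commute hra hcd).mul_pow]
    calc
      _ = walkLabel lab p * (walkLabel lab (a :: c ++ (d ++ r)) ^ k *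
            (walkLabel lab (a :: c ++ b) ^ j * lab a)) * walkLabel lab (r ++ a :: s) := by
        rw [walkLabel_cons]; simp only [mul_assoc]
      _ = walkLabel lab p * (walkLabel lab (a :: c ++ (d ++ r)) ^ k * lab a) *
            walkLabel lab (c ++ (b ++ [a])) ^ j * walkLabel lab (r ++ a :: s) := by
        rw [← hg.eq]; simp only [mul_assoc]
      _ = walkLabel lab p * (lab a * walkLabel lab (r ++ [a]) ^ k) *
            walkLabel lab (c ++ d) ^ k *
            walkLabel lab (c ++ (b ++ [a])) ^ j * walkLabel lab (r ++ a :: s) := by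
        rw [← hc1.eq, hct]; simp only [mul_assoc]
      _ = walkLabel lab (p ++ [a]) * walkLabel lab (c ++ d) ^ k *
            walkLabel lab (c ++ (b ++ [a])) ^ j * walkLabel lab (r ++ a :: s) := by
        rw [hr1.eq, ← mul_assoc, hP]; simp
      _ = walkLabel lab p * (lab a * walkLabel lab (c ++ (b ++ [a])) ^ j) *
            walkLabel lab (r ++ a :: s) := by
        rw [hkey]; simp [mul_assoc]
      _ = _ := by
        rw [hg.eq, walkLabel_cons]; simp only [mul_assoc]

/-- Closed walks along frequent edges can be inserted without changing the label. -/
theorem SwapLaw.label_insert [Finite M] [DecidableEq E] (hs : SwapLaw src tgt lab)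
    (hap : ∀ m : M, ∃ n : ℕ, m ^ n = m ^ (n + 1))
    {x y z : V} {u₁ u₂ c : List E} (hu : IsWalk src tgt x (u₁ ++ u₂) y)
    (hu₁ : IsWalk src tgt x u₁ z) (hc : IsWalk src tgt z c z)
    (hcu : ∀ e ∈ c, Nat.card M < (u₁ ++ u₂).count e) :
    walkLabel lab (u₁ ++ c ++ u₂) = walkLabel lab (u₁ ++ u₂) := by
  obtain ⟨d, hd, hd'⟩ := hs.exists_absorbed (b := []) hu hc rfl hcu
  obtain ⟨n, hn⟩ := hap (walkLabel lab c)
  have h0 := hd' n 0 u₁ u₂ rfl hu₁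
  have h1 := hd' n 1 u₁ u₂ rfl hu₁
  have hcd := hs.commute hc hd
  simp only [pow_zero, pow_one, mul_one, List.append_nil, walkLabel_append] at h0 h1 ⊢
  rw [← h1, ← h0]
  congr 1
  rw [mul_assoc]
  congr 1
  rw [hcd.mul_pow, mul_assoc, ← (hcd.pow_right n).eq, ← mul_assoc, ← pow_succ, ← hn]

/-- In-degree and out-degree along a walk agree except at its ends. -/
theorem IsWalk.countP_src_add [DecidableEq V] {x y : V} {l : List E}
    (h : IsWalk src tgt x l y) (z : V) :
    l.countP (fun e => src e = z) + (if y = z then 1 else 0) =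
      l.countP (fun e => tgt e = z) + (if x = z then 1 else 0) := by
  induction l generalizing x with
  | nil => obtain rfl := isWalk_nil.1 h; simp
  | cons e l ih =>
    obtain ⟨rfl, h⟩ := h
    have := ih h
    simp only [List.countP_cons, decide_eq_true_eq]
    omega

theorem IsWalk.exists_closed_extension [DecidableEq E] {x y z z' : V} {u v t : List E}
    (hu : IsWalk src tgt x u y) (hv : IsWalk src tgt x v y) (ht : IsWalk src tgt z t z')
    (ht0 : t ≠ []) (htv : (u ++ t).Subperm v) :
    ∃ c w, c ≠ [] ∧ IsWalk src tgt w c w ∧ (u ++ c).Subperm v := by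
  classical
  by_cases hz : z = z'
  · subst hz
    exact ⟨t, z, ht0, ht, htv⟩
  obtain ⟨b, hb, hbv⟩ : ∃ b, src b = z' ∧ (u ++ t).count b < v.count b := by
    by_contra! hne
    have h1 : v.countP (fun e => src e = z') ≤ (u ++ t).countP (fun e => src e = z') := by
      rw [List.countP_eq_length_filter, List.countP_eq_length_filter]
      apply List.Subperm.length_le
      rw [List.subperm_ext_iff]
      intro b hb
      have hb' : src b = z' := by simpa using (List.mem_filter.1 hb).2
      rw [List.count_filter (by simpa using hb'), List.count_filter (by simpa using hb')]
      exact hne b hb'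
    have h2 := htv.countP_le (fun e => decide (tgt e = z'))
    have h3 := hu.countP_src_add z'
    have h4 := hv.countP_src_add z'
    have h5 := ht.countP_src_add z'
    simp only [List.countP_append, hz, if_true, if_false] at h1 h2 h5
    omega
  have htv' : (u ++ (t ++ [b])).Subperm v := by
    rw [List.subperm_ext_iff]
    intro e _
    have := htv.count_le e
    by_cases he : b = e
    · subst he
      simp only [List.count_append, List.count_singleton_self] at hbv ⊢
      omega
    · simpa [he] using this
  have hlen := htv'.length_le
  exact IsWalk.exists_closed_extension hu hv (ht.append (l₂ := [b]) ⟨hb, rfl⟩) (by simp) htv'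
termination_by v.length - (u ++ t).length
decreasing_by simp at hlen ⊢; omega

/-- A walk dominating a coterminal shorter walk contains a closed walk in the difference. -/
theorem IsWalk.exists_closed_of_subperm [DecidableEq E] {x y : V} {u v : List E}
    (hu : IsWalk src tgt x u y) (hv : IsWalk src tgt x v y) (huv : u.Subperm v)
    (hlen : u.length < v.length) :
    ∃ c w, c ≠ [] ∧ IsWalk src tgt w c w ∧ (u ++ c).Subperm v := by
  obtain ⟨l, hlv⟩ := huv.exists_of_length_lt hlen
  exact hu.exists_closed_extension hv (t := [l]) ⟨rfl, rfl⟩ (by simp)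
    ((List.perm_append_singleton l u).subperm.trans hlv)

theorem SwapLaw.exists_insert [Finite M] [DecidableEq E] (hs : SwapLaw src tgt lab)
    (hap : ∀ m : M, ∃ n : ℕ, m ^ n = m ^ (n + 1)) {x y z : V} {u c : List E}
    (hu : IsWalk src tgt x u y) (hc0 : c ≠ []) (hc : IsWalk src tgt z c z)
    (hcu : ∀ e ∈ c, Nat.card M < u.count e) :
    ∃ u', IsWalk src tgt x u' y ∧ u'.Perm (u ++ c) ∧ walkLabel lab u' = walkLabel lab u := by
  obtain ⟨e, c', rfl⟩ := List.exists_cons_of_ne_nil hc0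
  have he : e ∈ u := List.count_pos_iff.1 (Nat.zero_lt_of_lt (hcu e List.mem_cons_self))
  obtain ⟨u₁, u₂, rfl, hu₁, hu₂⟩ := hu.exists_split_src he
  obtain rfl := hc.1
  refine ⟨u₁ ++ (e :: c') ++ u₂, (hu₁.append hc).append hu₂, ?_, hs.label_insert hap hu hu₁ hc hcu⟩
  rw [List.append_assoc, List.append_assoc]
  exact List.perm_append_comm.append_left _

/-- If `v` contains `u`, with additional edges only among frequent edges of `u`, the labels of
`u` and `v` agree. -/
theorem SwapLaw.label_eq_of_subperm [Finite M] [DecidableEq E] (hs : SwapLaw src tgt lab)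
    (hap : ∀ m : M, ∃ n : ℕ, m ^ n = m ^ (n + 1)) {x y : V} {u v : List E}
    (hu : IsWalk src tgt x u y) (hv : IsWalk src tgt x v y) (huv : u.Subperm v)
    (h : ∀ e, u.count e < v.count e → Nat.card M < u.count e) :
    walkLabel lab u = walkLabel lab v := by
  rcases huv.length_le.eq_or_lt with hlen | hlen
  · exact hs.label_eq_of_perm hu hv (huv.perm_of_length_le hlen.ge)
  obtain ⟨c, w, hc0, hc, hcv⟩ := hu.exists_closed_of_subperm hv huv hlen
  have hcount : ∀ e ∈ c, u.count e < v.count e := fun e he => by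
    have h1 := hcv.count_le e
    have h2 := List.count_pos_iff.2 he
    rw [List.count_append] at h1
    omega
  obtain ⟨u', hu', hperm, hlab⟩ := hs.exists_insert hap hu hc0 hc (fun e he => h e (hcount e he))
  have hlen' := hperm.length_eq
  have hcpos := List.length_pos_iff.2 hc0
  have hle := hlen'.trans_le hcv.length_le
  rw [List.length_append] at hlen'
  have hdecr : v.length - u'.length < v.length - u.length := by omega
  rw [← hlab]
  refine SwapLaw.label_eq_of_subperm hs hap hu' hv (hperm.subperm.trans hcv) fun e he => ?_
  rw [hperm.count_eq, List.count_append] at he ⊢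
  have := h e (by omega)
  omega
termination_by v.length - u.length

theorem List.exists_consecutive {α : Type*} [DecidableEq α] (P : α → Prop) [DecidablePred P]
    {a : α} (ha : ¬ P a) (l : List α) :
    (l.countP P + 2 ≤ l.count a → ∃ p r s, l = p ++ a :: r ++ a :: s ∧ ∀ b ∈ r, ¬ P b) ∧
    (l.countP P + 1 ≤ l.count a → (∃ r s, l = r ++ a :: s ∧ ∀ b ∈ r, ¬ P b) ∨
      ∃ p r s, l = p ++ a :: r ++ a :: s ∧ ∀ b ∈ r, ¬ P b) := by
  induction l with
  | nil => simp
  | cons b l ih =>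
    obtain ⟨ih₁, ih₂⟩ := ih
    have lift : (∃ p r s, l = p ++ a :: r ++ a :: s ∧ ∀ b ∈ r, ¬ P b) →
        ∃ p r s, b :: l = p ++ a :: r ++ a :: s ∧ ∀ b ∈ r, ¬ P b := by
      rintro ⟨p, r, s, rfl, h⟩
      exact ⟨b :: p, r, s, by simp, h⟩
    by_cases hb : b = a
    · subst hb
      simp only [List.count_cons_self, List.countP_cons_of_neg (p := (fun x => decide (P x)))
        (a := b) (l := l) (by simpa using ha)]
      refine ⟨fun h => ?_, fun _ => Or.inl ⟨[], l, rfl, by simp⟩⟩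
      rcases ih₂ (by omega) with ⟨r, s, rfl, hr⟩ | h
      · exact ⟨[], r, s, by simp, hr⟩
      · exact lift h
    · rw [List.count_cons_of_ne hb]
      by_cases hP : P b
      · rw [List.countP_cons_of_pos (by simpa using hP)]
        exact ⟨fun h => lift (ih₁ (by omega)), fun h => Or.inr (lift (ih₁ (by omega)))⟩
      · rw [List.countP_cons_of_neg (by simpa using hP)]
        refine ⟨fun h => lift (ih₁ (by omega)), fun h => ?_⟩
        rcases ih₂ (by omega) with ⟨r, s, rfl, hr⟩ | h
        · refine Or.inl ⟨b :: r, s, rfl, ?_⟩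
          simpa [hP] using hr
        · exact Or.inr (lift h)

theorem List.countP_count_le [Fintype E] [DecidableEq E] (n : ℕ) (u : List E) :
    u.countP (fun e => u.count e ≤ n) ≤ Fintype.card E * n := by
  rw [List.countP_eq_length_filter, ← List.sum_toFinset_count_eq_length]
  calc
    _ ≤ ∑ e ∈ (u.filter fun e => u.count e ≤ n).toFinset, n := by
      refine Finset.sum_le_sum fun e he => ?_
      rw [List.mem_toFinset, List.mem_filter] at he
      have h1 := of_decide_eq_true he.2
      exact ((List.filter_sublist).count_le e).trans h1
    _ ≤ _ := by
      rw [Finset.sum_const, smul_eq_mul]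
      exact Nat.mul_le_mul_right _ (Finset.card_le_univ _)

/-- A very frequent edge of a walk lies on a closed walk along frequent edges. -/
theorem IsWalk.exists_frequent_return [Fintype E] [DecidableEq E] {x y : V} {u : List E}
    (hu : IsWalk src tgt x u y) (n : ℕ) {a : E} (ha : Fintype.card E * n + n + 2 ≤ u.count a) :
    ∃ r, IsWalk src tgt (src a) (a :: r) (src a) ∧ ∀ e ∈ a :: r, n < u.count e := by
  have hlow := List.countP_count_le n u
  have han : ¬ u.count a ≤ n := by omega
  obtain ⟨p, r, s, hprs, hr⟩ := (List.exists_consecutive (fun e => u.count e ≤ n) han u).1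
    (by omega)
  have hu' := hprs ▸ hu
  rw [List.append_assoc, List.cons_append] at hu'
  have hr' := hu'.split_at_edge.2.split_at_edge.1
  refine ⟨r, ⟨rfl, hr'⟩, ?_⟩
  rw [List.forall_mem_cons]
  exact ⟨not_le.1 han, fun e he => not_le.1 (hr e he)⟩

theorem SwapLaw.label_eq_of_frequent [Finite M] [Fintype E] [DecidableEq E]
    (hs : SwapLaw src tgt lab) (hap : ∀ m : M, ∃ n : ℕ, m ^ n = m ^ (n + 1))
    {x y : V} {u v : List E}
    (hu : IsWalk src tgt x u y) (hv : IsWalk src tgt x v y)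
    (hlow : ∀ e, u.count e ≤ Nat.card M → u.count e = v.count e)
    (hhigh : ∀ e, Nat.card M < u.count e → Nat.card M < v.count e)
    (h : ∀ e, v.count e < u.count e →
      Fintype.card E * Nat.card M + Nat.card M + 2 ≤ u.count e) :
    walkLabel lab u = walkLabel lab v := by
  by_cases hle : ∀ e, u.count e ≤ v.count e
  · refine hs.label_eq_of_subperm hap hu hv (List.subperm_ext_iff.2 fun e _ => hle e) fun e he => ?_
    by_contra hlt
    have := hlow e (by omega)
    omega
  push Not at hle
  obtain ⟨a, ha⟩ := hle
  obtain ⟨r, hr, hr'⟩ := hu.exists_frequent_return (Nat.card M) (h a ha)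
  obtain ⟨v', hv', hperm, hlab⟩ := hs.exists_insert hap hv (by simp) hr
    (fun e he => hhigh e (hr' e he))
  have hcount : ∀ e, v'.count e = v.count e + (a :: r).count e := fun e => by
    rw [hperm.count_eq, List.count_append]
  have hdecr : ∑ e, (u.count e - v'.count e) < ∑ e, (u.count e - v.count e) := by
    refine Finset.sum_lt_sum (fun e _ => ?_) ⟨a, Finset.mem_univ _, ?_⟩
    · have := hcount e
      omega
    · have := hcount a
      rw [List.count_cons_self] at this
      omega
  rw [← hlab]
  refine SwapLaw.label_eq_of_frequent hs hap hu hv' (fun e he => ?_) (fun e he => ?_) (fun e he => ?_)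
  · have hm : e ∉ a :: r := fun hm => (hr' e hm).not_ge he
    rw [hcount, List.count_eq_zero_of_not_mem hm]
    exact hlow e he
  · have := hhigh e he
    have := hcount e
    omega
  · have := hcount e
    exact h e (by omega)
termination_by ∑ e, (u.count e - v.count e)

/-- Coterminal walks with the same edge multiplicities up to a large threshold have the same
label. -/
theorem SwapLaw.label_eq_of_threshold [Finite M] [Fintype E] [DecidableEq E]
    (hs : SwapLaw src tgt lab) (hap : ∀ m : M, ∃ n : ℕ, m ^ n = m ^ (n + 1))
    {x y : V} {u v : List E} (hu : IsWalk src tgt x u y) (hv : IsWalk src tgt x v y)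
    (h : ∀ j ≤ Fintype.card E * Nat.card M + Nat.card M + 2, ∀ e,
      (j ≤ u.count e ↔ j ≤ v.count e)) :
    walkLabel lab u = walkLabel lab v := by
  refine hs.label_eq_of_frequent hap hu hv (fun e he => ?_) (fun e he => ?_) (fun e he => ?_)
  · have h1 := h (u.count e) (by omega) e
    have h2 := h (u.count e + 1) (by omega) e
    omega
  · exact (h (Nat.card M + 1) (by omega) e).1 he
  · by_contra hlt
    have h1 := h (u.count e) (by omega) e
    omega

end Walks

section Windows

variable {V E A M : Type*} [Monoid M]

theorem swapLaw_of_idempotents {src tgt : E → V} {lab : E → M} (idem : V → M)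
    (hidem : ∀ x, idem x * idem x = idem x)
    (hsrc : ∀ e, idem (src e) * lab e = lab e) (htgt : ∀ e, lab e * idem (tgt e) = lab e)
    (hswap : ∀ x y a u b, idem x * a * idem y * u * idem x * b * idem y =
      idem x * b * idem y * u * idem x * a * idem y) :
    SwapLaw src tgt lab := by
  have hcomm : ∀ {x y l}, IsWalk src tgt x l y →
      idem x * walkLabel lab l = walkLabel lab l * idem y := by
    intro x y l h
    induction l generalizing x with
    | nil => obtain rfl := isWalk_nil.1 h; simp
    | cons e l ih =>
      obtain ⟨rfl, h⟩ := h
      rw [walkLabel_cons, ← mul_assoc, hsrc, mul_assoc, ← ih h, ← mul_assoc, htgt]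
  have habs : ∀ {x y l}, IsWalk src tgt x l y → l ≠ [] →
      idem x * walkLabel lab l = walkLabel lab l := by
    intro x y l h hl
    obtain ⟨e, l, rfl⟩ := List.exists_cons_of_ne_nil hl
    obtain ⟨rfl, -⟩ := h
    rw [walkLabel_cons, ← mul_assoc, hsrc]
  have hexp : ∀ {x y p q r}, IsWalk src tgt x p y → IsWalk src tgt y q x →
      IsWalk src tgt x r y → p ++ q ++ r ≠ [] →
      walkLabel lab (p ++ q ++ r) = idem x * walkLabel lab p * idem y * walkLabel lab q *
        idem x * walkLabel lab r * idem y := by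
    intro x y p q r hp hq hr hne
    have hp' := hcomm hp
    have hq' := hcomm hq
    have hr' := hcomm hr
    rw [← habs ((hp.append hq).append hr) hne, walkLabel_append, walkLabel_append]
    generalize walkLabel lab p = P at *
    generalize walkLabel lab q = Q at *
    generalize walkLabel lab r = R at *
    have h1 : idem x * P * idem y = idem x * P := by
      rw [mul_assoc, ← hp', ← mul_assoc, hidem]
    have h2 : idem x * R * idem y = idem x * R := by
      rw [mul_assoc, ← hr', ← mul_assoc, hidem]
    calc
      _ = idem x * P * Q * R := by simp only [mul_assoc]
      _ = idem x * P * idem y * Q * R := by rw [h1]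
      _ = idem x * P * (idem y * Q) * R := by simp only [mul_assoc]
      _ = idem x * P * Q * (idem x * R) := by rw [hq']; simp only [mul_assoc]
      _ = idem x * P * idem y * Q * (idem x * R * idem y) := by rw [h1, h2]
      _ = _ := by simp only [mul_assoc]
  intro x y p q r hp hq hr
  by_cases hne : p ++ q ++ r = []
  · simp only [List.append_eq_nil_iff] at hne
    obtain ⟨⟨rfl, rfl⟩, rfl⟩ := hne
    rfl
  · rw [hexp hp hq hr hne, hexp hr hq hp ?_, hswap]
    contrapose! hne
    simp only [List.append_eq_nil_iff] at hne ⊢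
    exact ⟨⟨hne.2, hne.1.2⟩, hne.1.1⟩

/-- `w` is left stable if its label is fixed by a nontrivial idempotent on the left. -/
def LeftStable (g : A → M) (w : List A) : Prop :=
  ∃ e : M, e ≠ 1 ∧ e * e = e ∧ e * walkLabel g w = walkLabel g w

theorem LeftStable.take_mono {g : A → M} {w : List A} {m n : ℕ} (h : LeftStable g (w.take m))
    (hmn : m ≤ n) : LeftStable g (w.take n) := by
  obtain ⟨e, he, hee, h⟩ := h
  refine ⟨e, he, hee, ?_⟩
  have : w.take n = w.take m ++ (w.take n).drop m := by
    conv_lhs => rw [← List.take_append_drop m (w.take n)]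
    rw [List.take_take, min_eq_left hmn]
  rw [this, walkLabel_append, ← mul_assoc, h]

theorem exists_leftStable [Finite M] {g : A → M}
    (hap : ∀ m : M, ∃ n : ℕ, m ^ n = m ^ (n + 1)) (hg : ∀ w ≠ [], walkLabel g w ≠ 1)
    {x : List A} (hx : Nat.card M ≤ x.length) :
    ∃ i < Nat.card M, LeftStable g ((x.drop i).take (Nat.card M)) := by
  obtain ⟨i, j, hij, hj, heq⟩ : ∃ i j, i < j ∧ j ≤ Nat.card M ∧
      walkLabel g ((x.take (Nat.card M)).drop i) = walkLabel g ((x.take (Nat.card M)).drop j) := by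
    have := Fintype.ofFinite M
    obtain ⟨i, j, hij, h⟩ := Fintype.exists_ne_map_eq_of_card_lt
      (fun i : Fin (Nat.card M + 1) => walkLabel g ((x.take (Nat.card M)).drop i))
      (by simp [Nat.card_eq_fintype_card])
    rcases lt_or_gt_of_ne (Fin.val_ne_iff.2 hij) with hlt | hlt
    · exact ⟨i, j, hlt, by omega, h⟩
    · exact ⟨j, i, hlt, by omega, h.symm⟩
  refine ⟨i, by omega, LeftStable.take_mono (m := Nat.card M - i) ?_ (Nat.sub_le _ _)⟩
  rw [← List.drop_take]
  obtain ⟨y, hy⟩ : ∃ y, y = x.take (Nat.card M) := ⟨_, rfl⟩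
  have hylen : y.length = Nat.card M := by simp [hy, hx]
  rw [← hy] at heq ⊢
  have hsplit : y.drop i = (y.drop i).take (j - i) ++ y.drop j := by
    conv_lhs => rw [← List.take_append_drop (j - i) (y.drop i)]
    rw [List.drop_drop, Nat.add_sub_cancel' hij.le]
  have hne : (y.drop i).take (j - i) ≠ [] := by
    apply List.length_pos_iff.1
    simp
    omega
  obtain ⟨t, ht⟩ : ∃ t, t = (y.drop i).take (j - i) := ⟨_, rfl⟩
  rw [← ht] at hsplit hne
  have hfix : walkLabel g t * walkLabel g (y.drop i) = walkLabel g (y.drop i) := by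
    conv_rhs => rw [hsplit, walkLabel_append, ← heq]
  have hfixn : ∀ n, walkLabel g t ^ n * walkLabel g (y.drop i) = walkLabel g (y.drop i) := by
    intro n
    induction n with
    | zero => simp
    | succ n ih => rw [pow_succ, mul_assoc, hfix, ih]
  obtain ⟨n, hn⟩ := hap (walkLabel g t)
  have hpow : ∀ m, walkLabel g t ^ (n + m) = walkLabel g t ^ n := by
    intro m
    induction m with
    | zero => rfl
    | succ m ih => rw [← add_assoc, pow_succ, ih, ← pow_succ, ← hn]
  refine ⟨walkLabel g t ^ (n + 1), ?_, ?_, hfixn _⟩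
  · have : walkLabel g t ^ (n + 1) = walkLabel g (List.replicate (n + 1) t).flatten := by
      generalize n + 1 = k
      induction k with
      | zero => simp
      | succ k ih => rw [pow_succ', ih, List.replicate_succ, List.flatten_cons, walkLabel_append]
    rw [this]
    exact hg _ (by simpa using hne)
  · rw [← pow_add, show n + 1 + (n + 1) = n + (n + 2) by omega, hpow, hpow]

/-- The first position of `x` at which a left stable factor of length `N` starts. -/
noncomputable def stablePos (g : A → M) (N : ℕ) (x : List A) : ℕ :=
  sInf {j | LeftStable g ((x.drop j).take N)}

open Classical in
/-- An idempotent fixing a left stable word. -/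
noncomputable def stabilizer (g : A → M) (w : List A) : M :=
  if h : LeftStable g w then h.choose else 1

theorem LeftStable.stabilizer_ne_one {g : A → M} {w : List A} (h : LeftStable g w) :
    stabilizer g w ≠ 1 := by
  rw [stabilizer, dif_pos h]
  exact h.choose_spec.1

theorem LeftStable.stabilizer_mul_self {g : A → M} {w : List A} (h : LeftStable g w) :
    stabilizer g w * stabilizer g w = stabilizer g w := by
  rw [stabilizer, dif_pos h]
  exact h.choose_spec.2.1

theorem LeftStable.stabilizer_mul {g : A → M} {w : List A} (h : LeftStable g w) :
    stabilizer g w * walkLabel g w = walkLabel g w := by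
  rw [stabilizer, dif_pos h]
  exact h.choose_spec.2.2

/-- The idempotent attached to the first left stable factor of length `N` of `x`. -/
noncomputable def windowIdem (g : A → M) (N : ℕ) (x : List A) : M :=
  stabilizer g ((x.drop (stablePos g N x)).take N)

/-- The part of `x` before the first left stable factor of length `N`. -/
noncomputable def windowHead (g : A → M) (N : ℕ) (x : List A) : List A :=
  x.take (stablePos g N x)

/-- The label of the transition between the consecutive windows `(a :: x).take (2 * N)`
and `x`. -/
noncomputable def windowLabel (g : A → M) (N : ℕ) (a : A) (x : List A) : M :=
  if stablePos g N ((a :: x).take (2 * N)) = 0 then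
    windowIdem g N ((a :: x).take (2 * N)) * walkLabel g (a :: windowHead g N x) *
      windowIdem g N x
  else windowIdem g N x

theorem leftStable_stablePos {g : A → M} {N i : ℕ} {x : List A}
    (h : LeftStable g ((x.drop i).take N)) : LeftStable g ((x.drop (stablePos g N x)).take N) :=
  Nat.sInf_mem (s := {j | LeftStable g ((x.drop j).take N)}) ⟨i, h⟩

theorem stablePos_le {g : A → M} {N i : ℕ} {x : List A}
    (h : LeftStable g ((x.drop i).take N)) : stablePos g N x ≤ i :=
  Nat.sInf_le (s := {j | LeftStable g ((x.drop j).take N)}) h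

theorem List.take_drop_take_two_mul {N j : ℕ} (hj : j ≤ N) (x : List A) :
    ((x.take (2 * N)).drop j).take N = (x.drop j).take N := by
  rw [List.drop_take, List.take_take, min_eq_left (by omega)]

theorem stablePos_take_cons {g : A → M} {N : ℕ} {a : A} {x : List A}
    (hx : stablePos g N x < N) (hxs : LeftStable g ((x.drop (stablePos g N x)).take N))
    (h0 : stablePos g N ((a :: x).take (2 * N)) ≠ 0) :
    stablePos g N ((a :: x).take (2 * N)) = stablePos g N x + 1 := by
  have h1 : LeftStable g ((((a :: x).take (2 * N)).drop (stablePos g N x + 1)).take N) := by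
    rwa [List.take_drop_take_two_mul (by omega), List.drop_succ_cons]
  have hle := stablePos_le h1
  have h2 := leftStable_stablePos h1
  obtain ⟨j, hj⟩ := Nat.exists_eq_succ_of_ne_zero h0
  rw [hj, List.take_drop_take_two_mul (by omega), Nat.succ_eq_add_one,
    List.drop_succ_cons] at h2
  have := stablePos_le h2
  omega

theorem windowIdem_take_cons {g : A → M} {N : ℕ} {a : A} {x : List A}
    (hx : stablePos g N x < N) (hxs : LeftStable g ((x.drop (stablePos g N x)).take N))
    (h0 : stablePos g N ((a :: x).take (2 * N)) ≠ 0) :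
    windowIdem g N ((a :: x).take (2 * N)) = windowIdem g N x := by
  rw [windowIdem, stablePos_take_cons hx hxs h0, List.take_drop_take_two_mul (by omega),
    List.drop_succ_cons, windowIdem]

/-- The walk of windows of length `m` through a word. -/
def windowWalk (m : ℕ) : List A → List (A × {x : List A // x.length = m})
  | [] => []
  | a :: u => if h : m ≤ u.length then (a, ⟨u.take m, by simp [h]⟩) :: windowWalk m u else []

/-- The window preceding a transition. -/
def windowSrc (m : ℕ) (e : A × {x : List A // x.length = m}) : {x : List A // x.length = m} :=
  ⟨(e.1 :: e.2.1).take m, by simp [e.2.2]⟩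

theorem isWalk_windowWalk (m : ℕ) (u : List A) (hu : m ≤ u.length)
    {x y : {x : List A // x.length = m}} (hx : u.take m = x.1)
    (hy : u.drop (u.length - m) = y.1) :
    IsWalk (windowSrc m) Prod.snd x (windowWalk m u) y := by
  induction u generalizing x with
  | nil =>
    rw [windowWalk, isWalk_nil]
    exact Subtype.ext (by rw [← hx, ← hy]; simp)
  | cons a u ih =>
    rw [windowWalk]
    split_ifs with h
    · rw [isWalk_cons]
      refine ⟨Subtype.ext ?_, ih h rfl ?_⟩
      · rw [← hx, windowSrc]
        cases m <;> simp [List.take_take]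
      · rw [← hy, List.length_cons, Nat.succ_sub h, List.drop_succ_cons]
    · have hm : m = (a :: u).length := le_antisymm hu (by simpa using h)
      rw [isWalk_nil]
      refine Subtype.ext ?_
      rw [← hx, ← hy, hm]
      simp

theorem count_windowWalk [DecidableEq A] {m : ℕ} [BEq (A × {x : List A // x.length = m})]
    [LawfulBEq (A × {x : List A // x.length = m})] (u : List A)
    (e : A × {x : List A // x.length = m}) :
    (windowWalk m u).count e = occCount (e.1 :: e.2.1) u := by
  induction u with
  | nil => rw [windowWalk, occCount_of_length_lt (by simp), List.count_nil]
  | cons a u ih =>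
    rw [windowWalk]
    split_ifs with h
    · rw [List.count_cons, ih, occCount_cons (by simp), add_comm]
      congr 1
      obtain ⟨b, x, hx⟩ := e
      simp [hx]
    · rw [occCount_of_length_lt (by simp [e.2.2]; omega), List.count_nil]

theorem walkLabel_eq_windowWalk {g : A → M} {N : ℕ}
    (hst : ∀ x : List A, x.length = 2 * N → stablePos g N x < N ∧
      LeftStable g ((x.drop (stablePos g N x)).take N))
    (u : List A) (hu : 2 * N ≤ u.length) {c : M}
    (hc : c = walkLabel (fun e => windowLabel g N e.1 e.2.1) (windowWalk (2 * N) u) *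
      walkLabel g ((u.drop (u.length - 2 * N)).drop
        (stablePos g N (u.drop (u.length - 2 * N))))) :
    walkLabel g u = walkLabel g (windowHead g N (u.take (2 * N))) * c ∧
      windowIdem g N (u.take (2 * N)) * c = c := by
  have hN : ∀ {x : List A}, x.length = 2 * N → 0 < N := fun h =>
    (Nat.zero_le _).trans_lt (hst _ h).1
  induction u generalizing c with
  | nil =>
    have := hst [] (by simp at hu ⊢; omega)
    simp at hu
    omega
  | cons a u ih =>
    rw [windowWalk] at hc
    split_ifs at hc with h
    · rw [walkLabel_cons, List.length_cons, Nat.succ_sub h, List.drop_succ_cons, mul_assoc] at hc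
      obtain ⟨c', hc'⟩ : ∃ c', c' = walkLabel (fun e => windowLabel g N e.1 e.2.1)
        (windowWalk (2 * N) u) * walkLabel g ((u.drop (u.length - 2 * N)).drop
        (stablePos g N (u.drop (u.length - 2 * N)))) := ⟨_, rfl⟩
      rw [← hc'] at hc
      obtain ⟨ih₁, ih₂⟩ := ih h hc'
      have hxl : (u.take (2 * N)).length = 2 * N := by simp [h]
      obtain ⟨hx, hxs⟩ := hst _ hxl
      have hy : ((a :: u.take (2 * N)).take (2 * N)) = (a :: u).take (2 * N) := by
        obtain ⟨k, hk⟩ := Nat.exists_eq_succ_of_ne_zero (show 2 * N ≠ 0 by have := hN hxl; omega)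
        rw [hk]
        simp [List.take_take]
      rw [windowLabel] at hc
      simp only [hy] at hc
      split_ifs at hc with h0
      · have hyl : ((a :: u).take (2 * N)).length = 2 * N := by simp; omega
        obtain ⟨-, hys⟩ := hst _ hyl
        have hid := hys.stabilizer_mul_self
        have hfix : windowIdem g N ((a :: u).take (2 * N)) * walkLabel g (a :: u) =
            walkLabel g (a :: u) := by
          have := hys.stabilizer_mul
          rw [windowIdem]
          rw [h0, List.drop_zero, List.take_take, min_eq_left (by omega)] at this ⊢
          rw [← congrArg (walkLabel g) (List.take_append_drop N (a :: u)), walkLabel_append,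
            ← mul_assoc, this]
        have hcu : c = walkLabel g (a :: u) := by
          rw [hc, mul_assoc, ih₂, walkLabel_cons, mul_assoc, mul_assoc, ← ih₁, ← walkLabel_cons,
            hfix]
        rw [hcu]
        exact ⟨by rw [windowHead, h0]; simp, hfix⟩
      · rw [← hy] at h0 ⊢
        rw [windowIdem_take_cons hx hxs h0, windowHead, stablePos_take_cons hx hxs h0, hc, ih₂]
        refine ⟨?_, ih₂⟩
        rw [walkLabel_cons, ih₁, List.take_take, min_eq_left (by omega), List.take_succ_cons,
          walkLabel_cons, mul_assoc, windowHead]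
    · have hul : (a :: u).length = 2 * N := le_antisymm (by simp; omega) hu
      rw [walkLabel_nil, one_mul, hul, Nat.sub_self, List.drop_zero] at hc
      rw [List.take_of_length_le hul.le, hc, windowHead, ← walkLabel_append,
        List.take_append_drop]
      refine ⟨rfl, ?_⟩
      rw [← List.take_append_drop N ((a :: u).drop _), walkLabel_append, ← mul_assoc,
        windowIdem, (hst _ hul).2.stabilizer_mul]

theorem exists_threshold_walkLabel_eq [Finite A] [DecidableEq A] [Finite M] (g : A → M)
    (hap : ∀ m : M, ∃ n : ℕ, m ^ n = m ^ (n + 1)) (hg : ∀ w ≠ [], walkLabel g w ≠ 1)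
    (hid : ∀ e f : M, e ≠ 1 → f ≠ 1 → e * e = e → f * f = f → ∀ a u b : M,
      e * a * f * u * e * b * f = e * b * f * u * e * a * f) :
    ∃ k ≥ 1, ∃ l ≥ 1, ∀ u v, ThresholdEquiv l k u v → walkLabel g u = walkLabel g v := by
  obtain ⟨N, hN⟩ : ∃ N, N = Nat.card M := ⟨_, rfl⟩
  have hst : ∀ x : List A, x.length = 2 * N → stablePos g N x < N ∧
      LeftStable g ((x.drop (stablePos g N x)).take N) := by
    intro x hx
    obtain ⟨i, hi, h⟩ := exists_leftStable hap hg (x := x) (by omega)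
    rw [← hN] at hi h
    exact ⟨(stablePos_le h).trans_lt hi, leftStable_stablePos h⟩
  have hNpos : 0 < N := hN ▸ Nat.card_pos
  have hfin : Finite {x : List A // x.length = 2 * N} :=
    (List.finite_length_eq A (2 * N)).to_subtype
  have := Fintype.ofFinite (A × {x : List A // x.length = 2 * N})
  have hidem : ∀ x : {x : List A // x.length = 2 * N},
      windowIdem g N x.1 * windowIdem g N x.1 = windowIdem g N x.1 :=
    fun x => (hst _ x.2).2.stabilizer_mul_self
  have hne : ∀ x : {x : List A // x.length = 2 * N}, windowIdem g N x.1 ≠ 1 :=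
    fun x => (hst _ x.2).2.stabilizer_ne_one
  have hswap : SwapLaw (windowSrc (A := A) (2 * N)) Prod.snd
      (fun e => windowLabel g N e.1 e.2.1) := by
    refine swapLaw_of_idempotents (fun x => windowIdem g N x.1) hidem (fun e => ?_) (fun e => ?_)
      fun x y => hid _ _ (hne x) (hne y) (hidem x) (hidem y)
    · simp only [windowLabel, windowSrc]
      split_ifs with h0
      · have := hidem (windowSrc _ e)
        rw [windowSrc] at this
        rw [← mul_assoc, ← mul_assoc, this]
      · rw [windowIdem_take_cons (hst _ e.2.2).1 (hst _ e.2.2).2 h0, hidem]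
    · simp only [windowLabel]
      split_ifs with h0
      · rw [mul_assoc, hidem]
      · exact hidem _
  refine ⟨2 * N + 1, by omega, Fintype.card (A × {x : List A // x.length = 2 * N}) * N + N + 2,
    by omega, fun u v huv => ?_⟩
  obtain rfl | ⟨hu, hv⟩ := huv.eq_or_le
  · rfl
  obtain ⟨htake, hdrop, hocc⟩ := huv
  rw [Nat.add_sub_cancel] at hu hv htake hdrop
  have hwalk : walkLabel (fun e => windowLabel g N e.1 e.2.1) (windowWalk (2 * N) u) =
      walkLabel (fun e => windowLabel g N e.1 e.2.1) (windowWalk (2 * N) v) := by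
    refine hswap.label_eq_of_threshold hap
      (x := ⟨u.take (2 * N), by simp [hu]⟩)
      (y := ⟨u.drop (u.length - 2 * N), by simp; omega⟩)
      (isWalk_windowWalk _ _ hu rfl rfl) (isWalk_windowWalk _ _ hv htake.symm hdrop.symm)
      fun j hj e => ?_
    rw [@count_windowWalk _ _ _ instBEqOfDecidableEq inferInstance,
      @count_windowWalk _ _ _ instBEqOfDecidableEq inferInstance]
    exact hocc j (hN ▸ hj) _ (by simp [e.2.2])
  rw [(walkLabel_eq_windowWalk hst u hu rfl).1, (walkLabel_eq_windowWalk hst v hv rfl).1, htake,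
    hdrop, hwalk]

end Windows

theorem walkLabel_coe_synClass {A : Type*} (L : Set (List A)) (w : List A) (hw : w ≠ []) :
    walkLabel (fun a => (synClass L [a] (by simp) : WithOne (SynSemigroup L))) w =
      synClass L w hw := by
  induction w with
  | nil => exact absurd rfl hw
  | cons a w ih =>
    rw [walkLabel_cons]
    by_cases h : w = []
    · subst h
      simp
    · rw [ih h, ← WithOne.coe_mul, synClass_mul]
      rfl

theorem WithOne.coe_spow {S : Type*} [Semigroup S] (s : S) (n : ℕ) :
    ((spow s n : S) : WithOne S) = (s : WithOne S) ^ (n + 1) := by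
  induction n with
  | zero => simp [spow]
  | succ n ih => rw [spow, WithOne.coe_mul, ih, ← pow_succ]

theorem WithOne.swap_of_idempotent {S : Type*} [Semigroup S]
    (h : ∀ e f : S, e * e = e → f * f = f → ∀ a u b : S,
      e * a * f * u * e * b * f = e * b * f * u * e * a * f)
    (e f : WithOne S) (he : e ≠ 1) (hf : f ≠ 1) (hee : e * e = e) (hff : f * f = f)
    (a u b : WithOne S) : e * a * f * u * e * b * f = e * b * f * u * e * a * f := by
  obtain ⟨e, rfl⟩ := WithOne.ne_one_iff_exists.1 he
  obtain ⟨f, rfl⟩ := WithOne.ne_one_iff_exists.1 hf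
  have hmul : ∀ (s : S) (t : WithOne S), ∃ r : S, (s : WithOne S) * t = r := fun s t => by
    induction t with
    | one => exact ⟨s, mul_one _⟩
    | coe t => exact ⟨s * t, rfl⟩
  obtain ⟨a', ha⟩ := hmul e a
  obtain ⟨b', hb⟩ := hmul e b
  obtain ⟨u', hu⟩ := hmul f u
  have key := congrArg ((↑) : S → WithOne S)
    (h e f (WithOne.coe_inj.1 hee) (WithOne.coe_inj.1 hff) a' u' b')
  simp only [WithOne.coe_mul] at key
  rw [← ha, ← hb, ← hu, ← mul_assoc (e : WithOne S) e a, ← mul_assoc (e : WithOne S) e b,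
    hee] at key
  have e₁ : ∀ x y : WithOne S, (e : WithOne S) * x * f * (f * u) * e * (e * y) * f =
      e * x * f * u * e * y * f := fun x y =>
    calc
      _ = (e : WithOne S) * x * (f * f) * u * (e * e) * y * f := by simp only [mul_assoc]
      _ = _ := by rw [hee, hff]
  rwa [e₁, e₁] at key

/-- Beauquier–Pin: a language of nonempty words is locally threshold testable iff
its syntactic semigroup `S` is finite and aperiodic and `eafuebf = ebfueaf` for
all idempotents `e, f ∈ S` and all `a, u, b ∈ S`. -/
theorem locally_threshold_testable_iff_syntactic_semigroup
    {A : Type*} [Fintype A] [DecidableEq A]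
    (L : Set (List A)) (hL : ∀ w ∈ L, w ≠ []) :
    LocallyThresholdTestable L ↔
      (Finite (SynSemigroup L) ∧
        (∀ s : SynSemigroup L, ∃ n : ℕ, spow s n = spow s n * s) ∧
        ∀ e f : SynSemigroup L, e * e = e → f * f = f →
          ∀ a u b : SynSemigroup L,
            e * a * f * u * e * b * f = e * b * f * u * e * a * f) := by
  constructor
  · rintro ⟨k, hk, l, -, h⟩
    exact ⟨h.finite_synSemigroup hk, h.aperiodic hk, fun e f he hf => h.swap hk he hf⟩
  · rintro ⟨hfin, hap, hswap⟩
    have : Finite (WithOne (SynSemigroup L)) := inferInstanceAs (Finite (Option _))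
    obtain ⟨k, hk, l, hl, h⟩ := exists_threshold_walkLabel_eq
      (fun a => (synClass L [a] (by simp) : WithOne (SynSemigroup L)))
      (fun m => by
        induction m with
        | one => exact ⟨0, by simp⟩
        | coe s =>
          obtain ⟨n, hn⟩ := hap s
          exact ⟨n + 1, by rw [pow_succ _ (n + 1), ← WithOne.coe_spow, ← WithOne.coe_mul, ← hn]⟩)
      (fun w hw => by
        rw [walkLabel_coe_synClass L w hw]
        exact WithOne.coe_ne_one)
      (WithOne.swap_of_idempotent hswap)
    refine ⟨k, hk, l, hl, fun u v hu hv htake hdrop hocc => ?_⟩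
    have huv := h u v ⟨htake, hdrop, hocc⟩
    rw [walkLabel_coe_synClass L u hu, walkLabel_coe_synClass L v hv, WithOne.coe_inj] at huv
    simpa using Quotient.exact huv [] []
end

section
/- A language L ⊆ Σ* over a finite alphabet Σ is piecewise testable if and only if its syntactic monoid M(L) is finite and J-trivial. -/
/-- Piecewise testable languages over `A`: the Boolean algebra generated by the
languages `Σ*a₁Σ*a₂Σ*···Σ*a_kΣ*` (i.e. the sets of words containing a fixed word
`[a₁,…,a_k]` as a not-necessarily-contiguous subsequence), closed under
complementation and finite union. -/
inductive PiecewiseTestable {A : Type*} : Set (List A) → Prop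
  | basic (l : List A) : PiecewiseTestable {w : List A | List.Sublist l w}
  | compl {L : Set (List A)} : PiecewiseTestable L → PiecewiseTestable Lᶜ
  | union {L₁ L₂ : Set (List A)} :
      PiecewiseTestable L₁ → PiecewiseTestable L₂ → PiecewiseTestable (L₁ ∪ L₂)

/-- A monoid is `J`-trivial if any two elements generating the same two-sided
ideal coincide. -/
def JTrivial (M : Type*) [Monoid M] : Prop :=
  ∀ x y : M, (∃ a b : M, x = a * y * b) → (∃ c d : M, y = c * x * d) → x = y

/-- The syntactic congruence of `L ⊆ Σ*` on the free monoid `Σ*`. -/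
def synMonoidSetoid {A : Type*} (L : Set (List A)) : Setoid (List A) where
  r u v := ∀ x y : List A, (x ++ u ++ y ∈ L ↔ x ++ v ++ y ∈ L)
  iseqv := ⟨fun _ _ _ => Iff.rfl, fun h x y => (h x y).symm,
    fun h1 h2 x y => (h1 x y).trans (h2 x y)⟩

/-- The syntactic monoid of `L`: the quotient of the free monoid `Σ*` by the
syntactic congruence. -/
def SynMonoid {A : Type*} (L : Set (List A)) : Type _ :=
  Quotient (synMonoidSetoid L)

instance {A : Type*} (L : Set (List A)) : Monoid (SynMonoid L) where
  mul := Quotient.map₂ (· ++ ·)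
    (by
      intro u u' hu v v' hv x y
      have h1 := hu x (v ++ y)
      have h2 := hv (x ++ u') y
      simp only [List.append_assoc] at h1 h2 ⊢
      exact h1.trans h2)
  one := Quotient.mk (synMonoidSetoid L) []
  mul_assoc a b c := by
    induction a using Quotient.ind
    induction b using Quotient.ind
    induction c using Quotient.ind
    apply Quotient.sound
    intro x y
    simp [List.append_assoc]
  one_mul a := by
    induction a using Quotient.ind
    apply Quotient.sound
    intro x y
    simp
  mul_one a := by
    induction a using Quotient.ind
    apply Quotient.sound
    intro x y
    simp

/-- Two words are equivalent when they have the same scattered subwords of length at most `k`. -/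
def SubwordEquiv {A : Type*} (k : ℕ) (u v : List A) : Prop :=
  ∀ s : List A, s.length ≤ k → (s.Sublist u ↔ s.Sublist v)

namespace SubwordEquiv

variable {A : Type*} {k : ℕ} {u v w : List A}

theorem symm (h : SubwordEquiv k u v) : SubwordEquiv k v u := fun s hs => (h s hs).symm

theorem trans (h : SubwordEquiv k u v) (h' : SubwordEquiv k v w) : SubwordEquiv k u w :=
  fun s hs => (h s hs).trans (h' s hs)

theorem mono {m : ℕ} (hm : m ≤ k) (h : SubwordEquiv k u v) : SubwordEquiv m u v :=
  fun s hs => h s (hs.trans hm)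

theorem append (h : SubwordEquiv k u v) (x y : List A) :
    SubwordEquiv k (x ++ u ++ y) (x ++ v ++ y) := by
  intro s hs
  simp only [List.sublist_append_iff]
  constructor
  all_goals
    rintro ⟨l₁, l₂, rfl, ⟨l₃, l₄, rfl, h₃, h₄⟩, h₂⟩
    simp only [List.length_append] at hs
    refine ⟨l₃ ++ l₄, l₂, rfl, ⟨l₃, l₄, rfl, h₃, ?_⟩, h₂⟩
  · exact (h l₄ (by omega)).1 h₄
  · exact (h l₄ (by omega)).2 h₄

theorem left_of_sublist (h : SubwordEquiv k u w) (huv : u.Sublist v) (hvw : v.Sublist w) :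
    SubwordEquiv k u v :=
  fun s hs => ⟨fun hu => hu.trans huv, fun hv => (h s hs).2 (hv.trans hvw)⟩

end SubwordEquiv

theorem List.Sublist.append_cons_split {A : Type*} {p q u v : List A} {b : A}
    (h : (p ++ b :: q).Sublist (u ++ v)) : (p ++ [b]).Sublist u ∨ (b :: q).Sublist v := by
  obtain ⟨l₁, l₂, he, h₁, h₂⟩ := List.sublist_append_iff.1 h
  rcases List.append_eq_append_iff.1 he with ⟨as, rfl, h'⟩ | ⟨bs, rfl, rfl⟩
  · cases as with
    | nil =>
      right
      simpa [h'] using h₂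
    | cons c as =>
      left
      simp only [List.cons_append, List.cons.injEq] at h'
      obtain ⟨rfl, -⟩ := h'
      exact (List.Sublist.append_left (by simp) p).trans h₁
  · exact Or.inr ((List.sublist_append_right _ _).trans h₂)

/-- A short subword gained by inserting the letter `b` uses that letter. -/
theorem exists_subword_of_not_subwordEquiv_insert {A : Type*} {k : ℕ} {u v : List A} {b : A}
    (h : ¬ SubwordEquiv k (u ++ v) (u ++ b :: v)) :
    ∃ p q : List A, p.length + 1 + q.length ≤ k ∧ p.Sublist u ∧ q.Sublist v ∧
      ¬ (p ++ b :: q).Sublist (u ++ v) := by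
  simp only [SubwordEquiv, not_forall] at h
  obtain ⟨s, hs, hne⟩ := h
  have hle : (u ++ v).Sublist (u ++ b :: v) := (List.sublist_cons_self b v).append_left u
  have hn : ¬ s.Sublist (u ++ v) := fun h' => hne ⟨fun _ => h'.trans hle, fun _ => h'⟩
  have hi : s.Sublist (u ++ b :: v) := by
    by_contra h'
    exact hne ⟨fun h => absurd h hn, fun h => absurd h h'⟩
  obtain ⟨p, s₂, rfl, hp, hs₂⟩ := List.sublist_append_iff.1 hi
  rcases List.sublist_cons_iff.1 hs₂ with h₂ | ⟨q, rfl, hq⟩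
  · exact absurd (hp.append h₂) hn
  · refine ⟨p, q, ?_, hp, hq, hn⟩
    simp only [List.length_append, List.length_cons] at hs
    omega

theorem subword_of_subwordEquiv_crossing {A : Type*} {k : ℕ} {u v w p q p' q' : List A} {a b : A}
    (hab : a ≠ b) (h : SubwordEquiv k (u ++ a :: v) (u ++ b :: w))
    (hp : p.Sublist u) (hq : q.Sublist (a :: v)) (hn : ¬ (p ++ b :: q).Sublist (u ++ a :: v))
    (hp' : p'.Sublist u) (hq' : q'.Sublist (b :: w))
    (hl : p.length + 1 + q'.length ≤ k) (hl' : p'.length + 1 + q'.length ≤ k) :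
    (p' ++ a :: q').Sublist (u ++ b :: w) := by
  obtain ⟨r, hrw, hqr, hr⟩ : ∃ r : List A, r.Sublist w ∧ q'.Sublist (b :: r) ∧
      r.length ≤ q'.length := by
    rcases List.sublist_cons_iff.1 hq' with h₁ | ⟨r, rfl, hr⟩
    · exact ⟨q', h₁, List.sublist_cons_self _ _, le_rfl⟩
    · exact ⟨r, hr, List.Sublist.refl _, by simp⟩
  have h₁ : (p ++ b :: r).Sublist (u ++ a :: v) :=
    (h _ (by simp only [List.length_append, List.length_cons]; omega)).2
      (hp.append (hrw.cons_cons b))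
  have h₂ : (b :: r).Sublist v := by
    rcases h₁.append_cons_split with h₂ | h₂
    · exact absurd (by simpa using h₂.append hq) hn
    · rcases List.sublist_cons_iff.1 h₂ with h₃ | ⟨r', h₃, -⟩
      · exact h₃
      · exact absurd (List.cons.inj h₃).1.symm hab
  exact (h _ (by simp only [List.length_append, List.length_cons]; omega)).1
    (hp'.append ((hqr.trans h₂).cons_cons a))

theorem SubwordEquiv.insert_or_insert {A : Type*} {k : ℕ} {u v w : List A} {a b : A}
    (hab : a ≠ b) (h : SubwordEquiv k (u ++ a :: v) (u ++ b :: w)) :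
    SubwordEquiv k (u ++ a :: v) (u ++ b :: a :: v) ∨
      SubwordEquiv k (u ++ b :: w) (u ++ a :: b :: w) := by
  by_contra! hc
  obtain ⟨p, q, hl, hp, hq, hn⟩ := exists_subword_of_not_subwordEquiv_insert hc.1
  obtain ⟨p', q', hl', hp', hq', hn'⟩ := exists_subword_of_not_subwordEquiv_insert hc.2
  by_cases hlen : p.length + 1 + q'.length ≤ k
  · exact hn' (subword_of_subwordEquiv_crossing hab h hp hq hn hp' hq' hlen hl')
  · exact hn (subword_of_subwordEquiv_crossing hab.symm h.symm hp' hq' hn' hp hq (by omega) hl)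

theorem SubwordEquiv.exists_common_superword_append {A : Type*} {k : ℕ} (u v w : List A)
    (h : SubwordEquiv k (u ++ v) (u ++ w)) :
    ∃ z : List A, (u ++ v).Sublist z ∧ (u ++ w).Sublist z ∧ SubwordEquiv k (u ++ v) z := by
  induction hn : v.length + w.length using Nat.strong_induction_on generalizing u v w with
  | _ n ih =>
    cases v with
    | nil => exact ⟨u ++ w, by simp, List.Sublist.refl _, h⟩
    | cons a v =>
      cases w with
      | nil => exact ⟨u ++ a :: v, List.Sublist.refl _, by simp, fun _ _ => Iff.rfl⟩
      | cons b w =>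
        simp only [List.length_cons] at hn
        by_cases hab : a = b
        · subst hab
          obtain ⟨z, h₁, h₂, h₃⟩ := ih (v.length + w.length) (by omega) (u ++ [a]) v w
            (by simpa using h) rfl
          exact ⟨z, by simpa using h₁, by simpa using h₂, by simpa using h₃⟩
        · rcases h.insert_or_insert hab with h' | h'
          · obtain ⟨z, h₁, h₂, h₃⟩ := ih ((a :: v).length + w.length)
              (by simp only [List.length_cons]; omega) (u ++ [b]) (a :: v) w
              (by simpa using h'.symm.trans h) rfl
            simp only [List.append_assoc, List.singleton_append] at h₁ h₂ h₃
            exact ⟨z, ((List.sublist_cons_self _ _).append_left u).trans h₁, h₂, h'.trans h₃⟩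
          · obtain ⟨z, h₁, h₂, h₃⟩ := ih (v.length + (b :: w).length)
              (by simp only [List.length_cons]; omega) (u ++ [a]) v (b :: w)
              (by simpa using h.trans h') rfl
            simp only [List.append_assoc, List.singleton_append] at h₁ h₂ h₃
            exact ⟨z, h₁, ((List.sublist_cons_self _ _).append_left u).trans h₂, h₃⟩

theorem JTrivial.mulOpposite {M : Type*} [Monoid M] (h : JTrivial M) : JTrivial Mᵐᵒᵖ := by
  rintro x y ⟨a, b, hab⟩ ⟨c, d, hcd⟩
  apply MulOpposite.unop_injective
  refine h _ _ ⟨b.unop, a.unop, ?_⟩ ⟨d.unop, c.unop, ?_⟩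
  · rw [hab]; simp [mul_assoc]
  · rw [hcd]; simp [mul_assoc]

theorem JTrivial.ncard_mul_lt {M : Type*} [Monoid M] [Finite M] (h : JTrivial M) {m c : M}
    (hne : m * c ≠ m) :
    (Set.range fun z => m * c * z).ncard < (Set.range fun z => m * z).ncard := by
  apply Set.ncard_lt_ncard _ (Set.toFinite _)
  refine ⟨?_, fun hsub => ?_⟩
  · rintro _ ⟨z, rfl⟩
    exact ⟨c * z, by simp [mul_assoc]⟩
  · obtain ⟨z, hz⟩ := hsub ⟨1, mul_one m⟩
    exact hne (h _ _ ⟨1, c, by simp⟩ ⟨1, z, by simpa using hz.symm⟩)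

/-- The letters at which the prefix products of `x` change, starting from `m`, form a subword
of `x` that cannot be extended by a further letter at which the product changes. -/
theorem JTrivial.exists_subword {A M : Type*} [Monoid M] [Finite M] (hM : JTrivial M) (f : A → M)
    (a : A) (x : List A) (m : M) (h : m * (x.map f).prod * f a ≠ m * (x.map f).prod) :
    ∃ s : List A, s.Sublist x ∧ ¬ (s ++ [a]).Sublist x ∧
      s.length < (Set.range fun z => m * z).ncard ∧
      ∀ b ∈ (s ++ [a]).head?, m * f b ≠ m := by
  induction x generalizing m with
  | nil =>
    refine ⟨[], List.Sublist.refl _, by simp, ?_, by simpa using h⟩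
    exact (Set.ncard_pos (Set.toFinite _)).2 ⟨_, 1, rfl⟩
  | cons c x ih =>
    simp only [List.map_cons, List.prod_cons, ← mul_assoc] at h
    obtain ⟨s, h₁, h₂, h₃, h₄⟩ := ih (m * f c) h
    by_cases hc : m * f c = m
    · rw [hc] at h₃ h₄
      refine ⟨s, h₁.cons c, fun h' => ?_, h₃, h₄⟩
      rcases List.sublist_cons_iff.1 h' with h'' | ⟨r, hr, -⟩
      · exact h₂ h''
      · exact h₄ c (by simp [hr]) hc
    · refine ⟨c :: s, h₁.cons_cons c, fun h' => ?_, ?_, ?_⟩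
      · exact h₂ (List.cons_sublist_cons.1 h')
      · have := hM.ncard_mul_lt hc
        simp only [List.length_cons]
        omega
      · simpa using hc

theorem JTrivial.exists_subword_right {A M : Type*} [Monoid M] [Finite M] (hM : JTrivial M)
    (f : A → M) (a : A) (x : List A) (h : (x.map f).prod * f a ≠ (x.map f).prod) :
    ∃ s : List A, s.Sublist x ∧ ¬ (s ++ [a]).Sublist x ∧ s.length < Nat.card M := by
  obtain ⟨s, h₁, h₂, h₃, -⟩ := hM.exists_subword f a x 1 (by simpa using h)
  exact ⟨s, h₁, h₂, h₃.trans_le (Set.ncard_le_card _)⟩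

theorem JTrivial.exists_subword_left {A M : Type*} [Monoid M] [Finite M] (hM : JTrivial M)
    (f : A → M) (a : A) (x : List A) (h : f a * (x.map f).prod ≠ (x.map f).prod) :
    ∃ s : List A, s.Sublist x ∧ ¬ (a :: s).Sublist x ∧ s.length < Nat.card M := by
  have hrev : (x.reverse.map fun b => MulOpposite.op (f b)).prod =
      MulOpposite.op (x.map f).prod := by
    rw [MulOpposite.op_list_prod, List.map_reverse, List.map_map]
    rfl
  have : Finite Mᵐᵒᵖ := Finite.of_equiv M MulOpposite.opEquiv
  obtain ⟨s, h₁, h₂, h₃⟩ := hM.mulOpposite.exists_subword_right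
    (fun b => MulOpposite.op (f b)) a x.reverse (by
      rw [hrev, ← MulOpposite.op_mul]
      exact fun h' => h (MulOpposite.op_injective h'))
  refine ⟨s.reverse, ?_, fun h' => h₂ ?_, ?_⟩
  · simpa using h₁.reverse
  · simpa using h'.reverse
  · simpa [Nat.card_congr MulOpposite.opEquiv.symm] using h₃

theorem JTrivial.prod_insert_eq {A M : Type*} [Monoid M] [Finite M] (hM : JTrivial M) (f : A → M)
    {x y : List A} {a : A} (h : SubwordEquiv (2 * Nat.card M) (x ++ y) (x ++ a :: y)) :
    ((x ++ y).map f).prod = ((x ++ a :: y).map f).prod := by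
  by_contra hne
  simp only [List.map_append, List.map_cons, List.prod_append, List.prod_cons] at hne
  obtain ⟨s, hs, hsn, hsl⟩ := hM.exists_subword_right f a x
    (fun h' => hne (by rw [← mul_assoc, h']))
  obtain ⟨t, ht, htn, htl⟩ := hM.exists_subword_left f a y (fun h' => hne (by rw [h']))
  have hst : (s ++ a :: t).Sublist (x ++ y) :=
    (h _ (by simp only [List.length_append, List.length_cons]; omega)).2
      (hs.append (ht.cons_cons a))
  exact hst.append_cons_split.elim hsn htn

theorem JTrivial.prod_eq_of_sublist {A M : Type*} [Monoid M] [Finite M] (hM : JTrivial M)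
    (f : A → M) {v w : List A} (hvw : v.Sublist w) (u : List A)
    (h : SubwordEquiv (2 * Nat.card M) (u ++ v) (u ++ w)) :
    ((u ++ v).map f).prod = ((u ++ w).map f).prod := by
  induction hvw generalizing u with
  | slnil => rfl
  | @cons v w a hvw ih =>
    have h₁ := h.left_of_sublist (hvw.append_left u) ((List.sublist_cons_self a w).append_left u)
    exact (ih u h₁).trans (hM.prod_insert_eq f (h₁.symm.trans h))
  | @cons_cons v w a hvw ih => simpa using ih (u ++ [a]) (by simpa using h)

theorem JTrivial.prod_eq_of_subwordEquiv {A M : Type*} [Monoid M] [Finite M] (hM : JTrivial M)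
    (f : A → M) {v w : List A} (h : SubwordEquiv (2 * Nat.card M) v w) :
    (v.map f).prod = (w.map f).prod := by
  obtain ⟨z, hv, hw, hz⟩ := SubwordEquiv.exists_common_superword_append [] v w h
  exact (hM.prod_eq_of_sublist f hv [] hz).trans
    (hM.prod_eq_of_sublist f hw [] (h.symm.trans hz)).symm

namespace SynMonoid

variable {A : Type*} {L : Set (List A)}

/-- The class of a word in the syntactic monoid. -/
def mk (L : Set (List A)) (w : List A) : SynMonoid L := Quotient.mk (synMonoidSetoid L) w

theorem mk_append (u v : List A) : mk L (u ++ v) = mk L u * mk L v := rfl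

theorem mk_surjective : Function.Surjective (mk L) := Quotient.mk_surjective

theorem prod_map_mk_singleton (w : List A) : (w.map fun a => mk L [a]).prod = mk L w := by
  induction w with
  | nil => rfl
  | cons a w ih => rw [List.map_cons, List.prod_cons, ih, ← mk_append, List.singleton_append]

theorem mem_iff_of_mk_eq {u v : List A} (h : mk L u = mk L v) : u ∈ L ↔ v ∈ L := by
  simpa using (Quotient.exact h : (synMonoidSetoid L).r u v) [] []

end SynMonoid

namespace PiecewiseTestable

variable {A : Type*} {L : Set (List A)}

theorem univ : PiecewiseTestable (Set.univ : Set (List A)) := by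
  simpa using basic ([] : List A)

theorem empty : PiecewiseTestable (∅ : Set (List A)) := by
  simpa using (univ (A := A)).compl

theorem inter {L₁ L₂ : Set (List A)} (h₁ : PiecewiseTestable L₁) (h₂ : PiecewiseTestable L₂) :
    PiecewiseTestable (L₁ ∩ L₂) := by
  simpa [Set.compl_union] using (h₁.compl.union h₂.compl).compl

theorem of_saturated {F : Set (List A)} (hF : F.Finite) (L : Set (List A))
    (hL : ∀ u v : List A, (∀ s ∈ F, s.Sublist u ↔ s.Sublist v) → u ∈ L → v ∈ L) :
    PiecewiseTestable L := by
  induction F, hF using Set.Finite.induction_on generalizing L with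
  | empty =>
    rcases L.eq_empty_or_nonempty with rfl | ⟨u, hu⟩
    · exact empty
    · rw [Set.eq_univ_of_forall fun v => hL u v (by simp) hu]
      exact univ
  | @insert s F _ _ ih =>
    have key (P : Set (List A)) : PiecewiseTestable
        {v | ∃ u ∈ L ∩ P, ∀ t ∈ F, t.Sublist u ↔ t.Sublist v} :=
      ih _ fun v w hvw ⟨u, hu, huv⟩ => ⟨u, hu, fun t ht => (huv t ht).trans (hvw t ht)⟩
    have hunion := ((key {w | s.Sublist w}).inter (basic s)).union
      ((key {w | s.Sublist w}ᶜ).inter (basic s).compl)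
    convert hunion using 1
    ext v
    constructor
    · intro hv
      by_cases hs : s.Sublist v
      · exact Or.inl ⟨⟨v, ⟨hv, hs⟩, fun _ _ => Iff.rfl⟩, hs⟩
      · exact Or.inr ⟨⟨v, ⟨hv, hs⟩, fun _ _ => Iff.rfl⟩, hs⟩
    · rintro (⟨⟨u, ⟨hu, hsu⟩, huv⟩, hsv⟩ | ⟨⟨u, ⟨hu, hsu⟩, huv⟩, hsv⟩)
      · refine hL u v ?_ hu
        rintro t (rfl | ht)
        exacts [⟨fun _ => hsv, fun _ => hsu⟩, huv t ht]
      · refine hL u v ?_ hu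
        rintro t (rfl | ht)
        exacts [⟨fun h => absurd h hsu, fun h => absurd h hsv⟩, huv t ht]

theorem of_subwordEquiv [Finite A] (k : ℕ)
    (hL : ∀ u v : List A, SubwordEquiv k u v → u ∈ L → v ∈ L) : PiecewiseTestable L :=
  of_saturated (List.finite_length_le A k) L hL

theorem exists_subwordEquiv (h : PiecewiseTestable L) :
    ∃ k, ∀ u v : List A, SubwordEquiv k u v → (u ∈ L ↔ v ∈ L) := by
  induction h with
  | basic l => exact ⟨l.length, fun u v huv => huv l le_rfl⟩
  | compl _ ih =>
    obtain ⟨k, hk⟩ := ih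
    exact ⟨k, fun u v huv => not_congr (hk u v huv)⟩
  | union _ _ ih₁ ih₂ =>
    obtain ⟨k₁, hk₁⟩ := ih₁
    obtain ⟨k₂, hk₂⟩ := ih₂
    exact ⟨max k₁ k₂, fun u v huv => or_congr (hk₁ u v (huv.mono (le_max_left _ _)))
      (hk₂ u v (huv.mono (le_max_right _ _)))⟩

theorem exists_mk_eq (h : PiecewiseTestable L) :
    ∃ k, ∀ u v : List A, SubwordEquiv k u v → SynMonoid.mk L u = SynMonoid.mk L v := by
  obtain ⟨k, hk⟩ := h.exists_subwordEquiv
  exact ⟨k, fun u v huv => Quotient.sound fun x y => hk _ _ (huv.append x y)⟩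

end PiecewiseTestable

/-- The set of scattered subwords of `u` of length at most `k`. -/
def shortSubwords {A : Type*} (k : ℕ) (u : List A) : Set {s : List A | s.length ≤ k} :=
  {s | s.1.Sublist u}

theorem shortSubwords_mono {A : Type*} (k : ℕ) {u v : List A} (h : u.Sublist v) :
    shortSubwords k u ⊆ shortSubwords k v := fun _ hs => List.Sublist.trans hs h

theorem subwordEquiv_of_shortSubwords_eq {A : Type*} {k : ℕ} {u v : List A}
    (h : shortSubwords k u = shortSubwords k v) : SubwordEquiv k u v :=
  fun s hs => Set.ext_iff.1 h ⟨s, hs⟩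

theorem exists_subwordEquiv_succ {A : Type*} [Finite A] (k : ℕ) (w : ℕ → List A)
    (hw : ∀ n, (w n).Sublist (w (n + 1))) : ∃ n, SubwordEquiv k (w n) (w (n + 1)) := by
  have : Finite {s : List A | s.length ≤ k} := (List.finite_length_le A k).to_subtype
  have hmono : Monotone fun n => shortSubwords k (w n) :=
    monotone_nat_of_le_succ fun n => shortSubwords_mono k (hw n)
  obtain ⟨n, hn⟩ := WellFoundedGT.monotone_chain_condition ⟨_, hmono⟩
  exact ⟨n, subwordEquiv_of_shortSubwords_eq (hn (n + 1) n.le_succ)⟩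

theorem PiecewiseTestable.finite_synMonoid {A : Type*} [Finite A] {L : Set (List A)}
    (h : PiecewiseTestable L) : Finite (SynMonoid L) := by
  obtain ⟨k, hk⟩ := h.exists_mk_eq
  have : Finite {s : List A | s.length ≤ k} := (List.finite_length_le A k).to_subtype
  refine Finite.of_injective
    (fun q => shortSubwords k (Function.surjInv SynMonoid.mk_surjective q)) fun p q hpq => ?_
  simpa only [Function.surjInv_eq] using hk _ _ (subwordEquiv_of_shortSubwords_eq hpq)

theorem PiecewiseTestable.jTrivial_synMonoid {A : Type*} [Finite A] {L : Set (List A)}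
    (h : PiecewiseTestable L) : JTrivial (SynMonoid L) := by
  obtain ⟨k, hk⟩ := h.exists_mk_eq
  rintro x y ⟨a, b, hx⟩ ⟨c, d, hy⟩
  obtain ⟨a, rfl⟩ := SynMonoid.mk_surjective a
  obtain ⟨b, rfl⟩ := SynMonoid.mk_surjective b
  obtain ⟨c, rfl⟩ := SynMonoid.mk_surjective c
  obtain ⟨d, rfl⟩ := SynMonoid.mk_surjective d
  obtain ⟨u, rfl⟩ := SynMonoid.mk_surjective x
  let w : ℕ → List A := fun n => (fun v => a ++ (c ++ v ++ d) ++ b)^[n] u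
  have hsucc (n : ℕ) : w (n + 1) = a ++ (c ++ w n ++ d) ++ b := Function.iterate_succ_apply' _ _ _
  have h₁ (n : ℕ) : (w n).Sublist (c ++ w n ++ d) :=
    (List.sublist_append_right _ _).trans (List.sublist_append_left _ _)
  have h₂ (n : ℕ) : (c ++ w n ++ d).Sublist (w (n + 1)) := by
    rw [hsucc]
    exact (List.sublist_append_right _ _).trans (List.sublist_append_left _ _)
  have hmk (n : ℕ) : SynMonoid.mk L (w n) = SynMonoid.mk L u := by
    induction n with
    | zero => rfl
    | succ n ih =>
      rw [hsucc]
      simp only [SynMonoid.mk_append, ih]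
      rw [← hy, ← hx]
  obtain ⟨n, hn⟩ := exists_subwordEquiv_succ k w fun n => (h₁ n).trans (h₂ n)
  have := hk _ _ (hn.left_of_sublist (h₁ n) (h₂ n))
  rwa [SynMonoid.mk_append, SynMonoid.mk_append, hmk, ← hy] at this

theorem JTrivial.piecewiseTestable {A : Type*} [Finite A] {L : Set (List A)}
    [Finite (SynMonoid L)] (h : JTrivial (SynMonoid L)) : PiecewiseTestable L := by
  refine PiecewiseTestable.of_subwordEquiv (2 * Nat.card (SynMonoid L)) fun u v huv => ?_
  have := h.prod_eq_of_subwordEquiv (fun a => SynMonoid.mk L [a]) huv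
  rw [SynMonoid.prod_map_mk_singleton, SynMonoid.prod_map_mk_singleton] at this
  exact (SynMonoid.mem_iff_of_mk_eq this).1

/-- Simon's theorem: a language `L ⊆ Σ*` is piecewise testable iff its syntactic
monoid is finite and `J`-trivial. -/
theorem piecewise_testable_iff_syntactic_monoid_JTrivial
    {A : Type*} [Fintype A] (L : Set (List A)) :
    PiecewiseTestable L ↔ (Finite (SynMonoid L) ∧ JTrivial (SynMonoid L)) := by
  exact ⟨fun h => ⟨h.finite_synMonoid, h.jTrivial_synMonoid⟩, fun ⟨_, h⟩ => h.piecewiseTestable⟩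
end
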